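/- arXiv:1607.02390 — 4 statements merged into one kernel-verified Lean document; each statement's English description precedes it below -/
import Mathlib

section
/- For every τ > 0 there exists a constant C > 0 such that for every h in the interval (0, (ã₁+τ)^(−3/2)] and every real E with −h^(−2/3) < E < 0, −h^(−2/3) − E > −ã₁, and u'(−h^(−2/3)−E)·v'(−E) = v'(−h^(−2/3)−E)·u'(−E) (i.e. E is the rescaled ground state E⁰_min at semiclassical parameter h), one has |E + h^(−2/3) − ã₁ + √3·α·(u'(−ã₁))²/ã₁ · exp(−4/(3h) + 2·ã₁·h^(−1/3))| ≤ C·h^(1/3)·exp(−4/(3h) + 2·ã₁·h^(−1/3)). -/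
open Real Set

/-- Derivative of the standard Airy function `Ai` expressed in the basis of the
canonical solutions `u`, `v` of the Airy equation (given their derivatives `u'`, `v'`). -/
noncomputable def AiD (u' v' : ℝ → ℝ) (x : ℝ) : ℝ :=
  u' x / ((3:ℝ) ^ ((2:ℝ)/3) * Real.Gamma (2/3))
    - v' x / ((3:ℝ) ^ ((1:ℝ)/3) * Real.Gamma (1/3))

/-- `α = Γ(1/3)/(3^(1/3)·Γ(2/3)) = −Ai(0)/Ai'(0)`. -/
noncomputable def airyAlpha : ℝ :=
  Real.Gamma (1/3) / ((3:ℝ) ^ ((1:ℝ)/3) * Real.Gamma (2/3))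

open MeasureTheory Filter Topology

/-- The moments `∫₀^∞ tⁿ exp(-t³/3 + z t) dt`, entire functions of `z`. -/
noncomputable def cubicMoment (n : ℕ) (z : ℂ) : ℂ :=
  ∫ t in Ioi (0:ℝ), (t:ℂ) ^ n * Complex.exp (-(t:ℂ) ^ 3 / 3 + z * t)

lemma neg_cube_add_linear_le (R : ℝ) {t : ℝ} (ht : 0 ≤ t) :
    -t ^ 3 / 3 + R * t ≤ (|R| + 1) * (3 * (|R| + 1) + 1) - t := by
  have h1 : R * t ≤ |R| * t := mul_le_mul_of_nonneg_right (le_abs_self R) ht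
  have hM : 1 ≤ |R| + 1 := by linarith [abs_nonneg R]
  set M := |R| + 1 with hMdef
  have h2 : R * t + t ≤ M * t := by rw [hMdef]; linarith
  have h3 : M * t - t ^ 3 / 3 ≤ M * (3 * M + 1) := by
    by_cases h : 3 * M ≤ t ^ 2
    · have : 0 ≤ t * (t ^ 2 - 3 * M) := mul_nonneg ht (by linarith)
      nlinarith
    · push Not at h
      have : t ≤ 3 * M + 1 := by nlinarith
      have h4 : M * t ≤ M * (3 * M + 1) := mul_le_mul_of_nonneg_left this (by linarith)
      have : 0 ≤ t ^ 3 := pow_nonneg ht 3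
      linarith
  linarith

lemma integrableOn_pow_mul_exp_neg_cube (n : ℕ) (R : ℝ) :
    IntegrableOn (fun t : ℝ => t ^ n * Real.exp (-t ^ 3 / 3 + R * t)) (Ioi 0) := by
  have h1 := (Real.GammaIntegral_convergent (s := n + 1) (by positivity)).const_mul
    (Real.exp ((|R| + 1) * (3 * (|R| + 1) + 1)))
  refine h1.mono' ?_ ?_
  · exact (Continuous.aestronglyMeasurable (by fun_prop))
  · refine (ae_restrict_mem measurableSet_Ioi).mono fun t ht => ?_
    have ht' : 0 ≤ t := le_of_lt ht
    rw [Real.norm_of_nonneg (by positivity)]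
    have h2 := Real.exp_le_exp.2 (neg_cube_add_linear_le R ht')
    rw [sub_eq_add_neg, Real.exp_add _ (-t)] at h2
    simp only [add_sub_cancel_right, Real.rpow_natCast]
    calc t ^ n * Real.exp (-t ^ 3 / 3 + R * t) ≤ t ^ n * _ :=
          mul_le_mul_of_nonneg_left h2 (by positivity)
      _ = _ := by ring

lemma norm_cubicMoment_integrand (n : ℕ) (z : ℂ) {t : ℝ} (ht : 0 ≤ t) :
    ‖(t:ℂ) ^ n * Complex.exp (-(t:ℂ) ^ 3 / 3 + z * t)‖
      = t ^ n * Real.exp (-t ^ 3 / 3 + z.re * t) := by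
  have h : (-(t:ℂ) ^ 3 / 3 + z * t) = ((-t ^ 3 / 3 : ℝ) : ℂ) + z * t := by push_cast; ring
  rw [norm_mul, norm_pow, Complex.norm_real, Real.norm_of_nonneg ht, Complex.norm_exp, h]
  simp only [Complex.add_re, Complex.ofReal_re, Complex.mul_re, Complex.ofReal_im, mul_zero,
    sub_zero]

lemma integrable_cubicMoment_integrand (n : ℕ) (z : ℂ) :
    IntegrableOn (fun t : ℝ => (t:ℂ) ^ n * Complex.exp (-(t:ℂ) ^ 3 / 3 + z * t)) (Ioi 0) := by
  refine (integrableOn_pow_mul_exp_neg_cube n z.re).mono'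
    (Continuous.aestronglyMeasurable (by fun_prop)) ?_
  refine (ae_restrict_mem measurableSet_Ioi).mono fun t ht => ?_
  rw [norm_cubicMoment_integrand n z (le_of_lt ht)]

lemma hasDerivAt_cubicMoment (n : ℕ) (z : ℂ) :
    HasDerivAt (cubicMoment n) (cubicMoment (n + 1) z) z := by
  refine (hasDerivAt_integral_of_dominated_loc_of_deriv_le (μ := volume.restrict (Ioi (0:ℝ)))
    (F := fun (z : ℂ) (t : ℝ) => (t:ℂ) ^ n * Complex.exp (-(t:ℂ) ^ 3 / 3 + z * t))
    (F' := fun (z : ℂ) (t : ℝ) => (t:ℂ) ^ (n + 1) * Complex.exp (-(t:ℂ) ^ 3 / 3 + z * t))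
    (bound := fun t => t ^ (n + 1) * Real.exp (-t ^ 3 / 3 + (z.re + 1) * t))
    (Metric.ball_mem_nhds z one_pos) ?_ (integrable_cubicMoment_integrand n z) ?_ ?_
    (integrableOn_pow_mul_exp_neg_cube (n + 1) (z.re + 1)) ?_).2
  · exact Eventually.of_forall fun w => (integrable_cubicMoment_integrand n w).1
  · exact (integrable_cubicMoment_integrand (n + 1) z).1
  · refine (ae_restrict_mem measurableSet_Ioi).mono fun t ht w hw => ?_
    have ht' : 0 ≤ t := le_of_lt ht
    rw [norm_cubicMoment_integrand _ w ht']
    have h1 : w.re ≤ z.re + 1 := by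
      have := (Complex.abs_re_le_norm (w - z)).trans (le_of_lt (mem_ball_iff_norm.1 hw))
      rw [Complex.sub_re] at this
      linarith [le_abs_self (w.re - z.re)]
    gcongr
  · refine Eventually.of_forall fun t w _ => ?_
    have h := (((hasDerivAt_id w).mul_const (t:ℂ)).const_add (-(t:ℂ) ^ 3 / 3)).cexp.const_mul
      ((t:ℂ) ^ n)
    refine h.congr_deriv ?_
    simp only [id]
    ring

lemma cubicMoment_two (z : ℂ) : cubicMoment 2 z = 1 + z * cubicMoment 0 z := by
  have hd : ∀ t ∈ Ici (0:ℝ), HasDerivAt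
      (fun t : ℝ => Complex.exp (-(t:ℂ) ^ 3 / 3 + z * t))
      (z * ((t:ℂ) ^ 0 * Complex.exp (-(t:ℂ) ^ 3 / 3 + z * t))
        - (t:ℂ) ^ 2 * Complex.exp (-(t:ℂ) ^ 3 / 3 + z * t)) t := by
    intro t _
    have h0 : HasDerivAt (fun t : ℝ => (t:ℂ)) 1 t := Complex.ofRealCLM.hasDerivAt
    have h := (((h0.pow 3).neg.div_const 3).add (h0.const_mul z)).cexp
    refine h.congr_deriv ?_
    simp only [Pi.add_apply, Pi.neg_apply, Pi.pow_apply]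
    push_cast
    ring
  have hInt := ((integrable_cubicMoment_integrand 0 z).const_mul z).sub
    (integrable_cubicMoment_integrand 2 z)
  have hlim : Tendsto (fun t : ℝ => Complex.exp (-(t:ℂ) ^ 3 / 3 + z * t)) atTop (𝓝 0) := by
    rw [tendsto_zero_iff_norm_tendsto_zero]
    have h1 : Tendsto (fun t : ℝ => Real.exp ((|z.re| + 1) * (3 * (|z.re| + 1) + 1)) *
        Real.exp (-t)) atTop (𝓝 0) := by
      simpa using (Real.tendsto_exp_neg_atTop_nhds_zero).const_mul
        (Real.exp ((|z.re| + 1) * (3 * (|z.re| + 1) + 1)))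
    refine squeeze_zero' (Eventually.of_forall fun t => norm_nonneg _) ?_ h1
    filter_upwards [eventually_ge_atTop 0] with t ht
    have h2 := norm_cubicMoment_integrand 0 z ht
    simp only [pow_zero, one_mul] at h2
    rw [h2, ← Real.exp_add]
    exact Real.exp_le_exp.2 (by linarith [neg_cube_add_linear_le z.re ht])
  have h := integral_Ioi_of_hasDerivAt_of_tendsto' hd hInt hlim
  rw [integral_sub ((integrable_cubicMoment_integrand 0 z).const_mul z)
    (integrable_cubicMoment_integrand 2 z), integral_const_mul] at h
  simp only [Complex.ofReal_zero] at h
  norm_num at h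
  unfold cubicMoment
  simp only [pow_zero, one_mul]
  linear_combination -h

lemma cubicMoment_ofReal (n : ℕ) (x : ℝ) :
    cubicMoment n x = ((∫ t in Ioi (0:ℝ), t ^ n * Real.exp (-t ^ 3 / 3 + x * t) : ℝ) : ℂ) := by
  rw [cubicMoment, ← integral_complex_ofReal]
  congr 1
  ext t
  push_cast
  rfl

lemma integral_pow_mul_exp_neg_cube (n : ℕ) :
    ∫ t in Ioi (0:ℝ), t ^ n * Real.exp (-t ^ 3 / 3 + 0 * t)
      = (1 / 3 : ℝ) ^ (-((n:ℝ) + 1) / 3) * (1 / 3) * Real.Gamma ((n + 1) / 3) := by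
  rw [← integral_rpow_mul_exp_neg_mul_rpow (p := 3) (q := n) (b := 1 / 3) (by norm_num)
    (by have : (0:ℝ) ≤ n := Nat.cast_nonneg n
        linarith) (by norm_num)]
  refine setIntegral_congr_fun measurableSet_Ioi fun t ht => ?_
  have h3 : t ^ (3:ℝ) = t ^ 3 := by exact_mod_cast Real.rpow_natCast t 3
  simp only [Real.rpow_natCast, h3]
  congr 2
  ring

lemma norm_cubicMoment_le (n : ℕ) {z : ℂ} (hz : z.re ≤ 0) :
    ‖cubicMoment n z‖ ≤ ∫ t in Ioi (0:ℝ), t ^ n * Real.exp (-t ^ 3 / 3 + 0 * t) := by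
  refine norm_integral_le_of_norm_le (integrableOn_pow_mul_exp_neg_cube n 0) ?_
  refine (ae_restrict_mem measurableSet_Ioi).mono fun t ht => ?_
  have ht' : 0 ≤ t := le_of_lt ht
  rw [norm_cubicMoment_integrand _ z ht']
  gcongr

/-- The Wronskian of two solutions of the Airy equation is constant. -/
lemma airy_wronskian_eq {f f' k k' : ℝ → ℝ}
    (hf : ∀ x, HasDerivAt f (f' x) x) (hf' : ∀ x, HasDerivAt f' (x * f x) x)
    (hk : ∀ x, HasDerivAt k (k' x) x) (hk' : ∀ x, HasDerivAt k' (x * k x) x) (x : ℝ) :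
    f x * k' x - f' x * k x = f 0 * k' 0 - f' 0 * k 0 := by
  have hd : ∀ x, HasDerivAt (fun x => f x * k' x - f' x * k x) 0 x := fun x =>
    (((hf x).mul (hk' x)).sub ((hf' x).mul (hk x))).congr_deriv (by ring)
  exact is_const_of_deriv_eq_zero (fun x => (hd x).differentiableAt)
    (fun x => (hd x).deriv) x 0

/-- Any solution of the Airy equation is the combination of the canonical ones given by its
Cauchy data at the origin. -/
lemma airy_eq_combination {u v u' v' g g' : ℝ → ℝ}
    (hu : ∀ x, HasDerivAt u (u' x) x) (huAiry : ∀ x, HasDerivAt u' (x * u x) x)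
    (hv : ∀ x, HasDerivAt v (v' x) x) (hvAiry : ∀ x, HasDerivAt v' (x * v x) x)
    (hu0 : u 0 = 1) (hu'0 : u' 0 = 0) (hv0 : v 0 = 0) (hv'0 : v' 0 = 1)
    (hg : ∀ x, HasDerivAt g (g' x) x) (hgAiry : ∀ x, HasDerivAt g' (x * g x) x) (x : ℝ) :
    g' x = g 0 * u' x + g' 0 * v' x := by
  have h1 := airy_wronskian_eq hu huAiry hv hvAiry x
  have h2 := airy_wronskian_eq hg hgAiry hu huAiry x
  have h3 := airy_wronskian_eq hg hgAiry hv hvAiry x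
  rw [hu0, hu'0, hv0, hv'0] at h1
  rw [hu0, hu'0] at h2
  rw [hv0, hv'0] at h3
  linear_combination (-g' x) * h1 - v' x * h2 + u' x * h3

/-- The real moments `∫₀^∞ tⁿ exp(-t³/3 + x t) dt`. -/
noncomputable def cubicMomentReal (n : ℕ) (x : ℝ) : ℝ :=
  ∫ t in Ioi (0:ℝ), t ^ n * Real.exp (-t ^ 3 / 3 + x * t)

lemma cubicMomentReal_zero_pos (n : ℕ) : 0 < cubicMomentReal n 0 := by
  rw [cubicMomentReal, integral_pow_mul_exp_neg_cube]
  have := Real.Gamma_pos_of_pos (s := ((n:ℝ) + 1) / 3) (by positivity)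
  positivity

/-- The primitive cube root of unity in the upper half plane. -/
noncomputable def cubeRootUnity : ℂ := ⟨-1 / 2, Real.sqrt 3 / 2⟩

lemma cubeRootUnity_sq : cubeRootUnity ^ 2 = -1 - cubeRootUnity := by
  have h3 : Real.sqrt 3 * Real.sqrt 3 = 3 := Real.mul_self_sqrt (by norm_num)
  apply Complex.ext
  · simp only [cubeRootUnity, sq, Complex.mul_re, Complex.sub_re, Complex.neg_re, Complex.one_re]
    linarith
  · simp only [cubeRootUnity, sq, Complex.mul_im, Complex.sub_im, Complex.neg_im, Complex.one_im]
    ring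

lemma norm_cubeRootUnity : ‖cubeRootUnity‖ = 1 := by
  have h3 : Real.sqrt 3 * Real.sqrt 3 = 3 := Real.mul_self_sqrt (by norm_num)
  have h : ‖cubeRootUnity‖ ^ 2 = 1 := by
    rw [← Complex.normSq_eq_norm_sq, Complex.normSq_apply]
    simp only [cubeRootUnity]
    linarith
  nlinarith [norm_nonneg cubeRootUnity]

lemma hasDerivAt_re_cubicMoment (n : ℕ) (c : ℂ) (x : ℝ) :
    HasDerivAt (fun x : ℝ => (cubicMoment n x + c * cubicMoment n (cubeRootUnity * x)).re)
      (cubicMoment (n + 1) x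
        + c * cubeRootUnity * cubicMoment (n + 1) (cubeRootUnity * x)).re x := by
  have h1 := hasDerivAt_cubicMoment n (x:ℂ)
  have h2 := ((hasDerivAt_cubicMoment n (cubeRootUnity * x)).comp (x:ℂ)
    ((hasDerivAt_id (x:ℂ)).const_mul cubeRootUnity)).const_mul c
  refine ((h1.add h2).real_of_complex).congr_deriv ?_
  congr 1
  ring

lemma airy_re_cubicMoment {u v u' v' : ℝ → ℝ}
    (hu : ∀ x, HasDerivAt u (u' x) x) (huAiry : ∀ x, HasDerivAt u' (x * u x) x)
    (hv : ∀ x, HasDerivAt v (v' x) x) (hvAiry : ∀ x, HasDerivAt v' (x * v x) x)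
    (hu0 : u 0 = 1) (hu'0 : u' 0 = 0) (hv0 : v 0 = 0) (hv'0 : v' 0 = 1)
    {c : ℂ} (hc : (1 + c * cubeRootUnity ^ 2).re = 0) (x : ℝ) :
    (cubicMoment 1 x + c * cubeRootUnity * cubicMoment 1 (cubeRootUnity * x)).re
      = cubicMomentReal 0 0 * (1 + c.re) * u' x
        + cubicMomentReal 1 0 * (1 + (c * cubeRootUnity).re) * v' x := by
  have hg := hasDerivAt_re_cubicMoment 0 c
  have hg' : ∀ x : ℝ, HasDerivAt
      (fun x : ℝ => (cubicMoment 1 x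
        + c * cubeRootUnity * cubicMoment 1 (cubeRootUnity * x)).re)
      (x * (cubicMoment 0 x + c * cubicMoment 0 (cubeRootUnity * x)).re) x := by
    intro x
    refine (hasDerivAt_re_cubicMoment 1 (c * cubeRootUnity) x).congr_deriv ?_
    have h3 : cubeRootUnity ^ 3 = 1 := by
      linear_combination (cubeRootUnity - 1) * cubeRootUnity_sq
    rw [show (1 + 1 : ℕ) = 2 from rfl, cubicMoment_two, cubicMoment_two]
    have h4 : 1 + x * cubicMoment 0 x + c * cubeRootUnity * cubeRootUnity
          * (1 + cubeRootUnity * x * cubicMoment 0 (cubeRootUnity * x))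
        = (1 + c * cubeRootUnity ^ 2)
          + x * (cubicMoment 0 x + c * cubicMoment 0 (cubeRootUnity * x)) := by
      linear_combination c * x * cubicMoment 0 (cubeRootUnity * x) * h3
    rw [h4, Complex.add_re, hc, Complex.re_ofReal_mul, zero_add]
  have h := airy_eq_combination hu huAiry hv hvAiry hu0 hu'0 hv0 hv'0 hg hg' x
  have hz : ∀ n, cubicMoment n 0 = (cubicMomentReal n 0 : ℂ) := fun n => by
    simpa [cubicMomentReal] using cubicMoment_ofReal n 0
  rw [h]
  simp only [Complex.ofReal_zero, mul_zero, hz, Complex.add_re, Complex.re_mul_ofReal,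
    Complex.ofReal_re]
  ring

lemma cubicMoment_airy {u v u' v' : ℝ → ℝ}
    (hu : ∀ x, HasDerivAt u (u' x) x) (huAiry : ∀ x, HasDerivAt u' (x * u x) x)
    (hv : ∀ x, HasDerivAt v (v' x) x) (hvAiry : ∀ x, HasDerivAt v' (x * v x) x)
    (hu0 : u 0 = 1) (hu'0 : u' 0 = 0) (hv0 : v 0 = 0) (hv'0 : v' 0 = 1)
    {x : ℝ} (hx : 0 ≤ x) :
    |3 * cubicMomentReal 0 0 * u' x - cubicMomentReal 1 x| ≤ 2 * cubicMomentReal 1 0 ∧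
    |3 * cubicMomentReal 0 0 * u' x - 3 * cubicMomentReal 1 0 * v' x|
      ≤ 4 * cubicMomentReal 1 0 := by
  have hsq := cubeRootUnity_sq
  have h3 : cubeRootUnity ^ 3 = 1 := by
    linear_combination (cubeRootUnity - 1) * cubeRootUnity_sq
  have hre : cubeRootUnity.re = -1 / 2 := rfl
  have e1 := airy_re_cubicMoment hu huAiry hv hvAiry hu0 hu'0 hv0 hv'0 (c := 2)
    (by rw [hsq]; simp [hre]; norm_num) x
  have e2 := airy_re_cubicMoment hu huAiry hv hvAiry hu0 hu'0 hv0 hv'0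
    (c := 2 * cubeRootUnity ^ 2)
    (by
      rw [show 1 + 2 * cubeRootUnity ^ 2 * cubeRootUnity ^ 2 = 1 + 2 * cubeRootUnity by
        linear_combination 2 * cubeRootUnity * h3]
      simp [hre]
      norm_num) x
  rw [show 2 * cubeRootUnity ^ 2 * cubeRootUnity = 2 by linear_combination 2 * h3, hsq] at e2
  have hJ : cubicMoment 1 x = (cubicMomentReal 1 x : ℂ) := cubicMoment_ofReal 1 x
  have hb : ‖cubicMoment 1 (cubeRootUnity * x)‖ ≤ cubicMomentReal 1 0 := by
    refine norm_cubicMoment_le 1 ?_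
    rw [Complex.re_mul_ofReal, hre]
    linarith
  set K := cubicMoment 1 (cubeRootUnity * x)
  have hK1 : |K.re| ≤ cubicMomentReal 1 0 := (Complex.abs_re_le_norm _).trans hb
  have hK2 : |(cubeRootUnity * K).re| ≤ cubicMomentReal 1 0 := by
    refine (Complex.abs_re_le_norm _).trans ?_
    rwa [norm_mul, norm_cubeRootUnity, one_mul]
  have r2 : ∀ z : ℂ, (2 * z).re = 2 * z.re := fun z => by simp
  rw [hJ, Complex.add_re, Complex.ofReal_re, mul_assoc, r2] at e1
  rw [hJ, Complex.add_re, Complex.ofReal_re, r2] at e2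
  simp only [r2, Complex.sub_re, Complex.neg_re, Complex.one_re, hre, Complex.re_ofNat] at e1 e2
  rw [abs_le] at hK1 hK2
  refine ⟨abs_le.2 ?_, abs_le.2 ?_⟩ <;> constructor <;> linarith

lemma integrable_abs_pow_mul_exp_neg_mul_sq {b : ℝ} (hb : 0 < b) (n : ℕ) :
    Integrable (fun s : ℝ => |s| ^ n * Real.exp (-b * s ^ 2)) := by
  have h := (integrable_rpow_mul_exp_neg_mul_sq hb (s := n)
    (by have : (0:ℝ) ≤ n := Nat.cast_nonneg n
        linarith)).norm
  refine h.congr (Eventually.of_forall fun s => ?_)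
  simp

lemma integral_abs_pow_mul_exp_neg_mul_sq {b : ℝ} (hb : 0 < b) (n : ℕ) :
    ∫ s : ℝ, |s| ^ n * Real.exp (-b * s ^ 2)
      = b ^ (-((n:ℝ) + 1) / 2) * Real.Gamma ((n + 1) / 2) := by
  have h := integral_comp_abs (f := fun s => s ^ n * Real.exp (-b * s ^ 2))
  simp only [sq_abs] at h
  rw [h]
  have h2 := integral_rpow_mul_exp_neg_mul_rpow (p := 2) (q := n) (b := b) (by norm_num)
    (by have : (0:ℝ) ≤ n := Nat.cast_nonneg n
        linarith) hb
  simp only [Real.rpow_natCast, Real.rpow_two] at h2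
  rw [h2]
  ring

lemma abs_exp_sub_exp_le (x y z : ℝ) (hx : x ≤ z) (hy : y ≤ z) :
    |Real.exp x - Real.exp y| ≤ |x - y| * Real.exp z := by
  wlog hxy : y ≤ x generalizing x y
  · rw [abs_sub_comm, abs_sub_comm x]
    exact this y x hy hx (le_of_not_ge hxy)
  rw [abs_of_nonneg (sub_nonneg.2 (Real.exp_le_exp.2 hxy)), abs_of_nonneg (sub_nonneg.2 hxy)]
  have h1 : Real.exp y = Real.exp x * Real.exp (y - x) := by rw [← Real.exp_add]; ring_nf
  have h2 := Real.add_one_le_exp (y - x)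
  calc Real.exp x - Real.exp y ≤ Real.exp x * (x - y) := by
        rw [h1]; nlinarith [Real.exp_pos x]
    _ ≤ Real.exp z * (x - y) :=
        mul_le_mul_of_nonneg_right (Real.exp_le_exp.2 hx) (sub_nonneg.2 hxy)
    _ = _ := mul_comm _ _

/-- Laplace's method for the first moment. -/
lemma abs_cubicMomentReal_one_sub_le {a : ℝ} (ha : 0 < a) :
    |cubicMomentReal 1 (a ^ 2) * Real.exp (-(2 / 3) * a ^ 3) - Real.sqrt (π * a)|
      ≤ 9 / 4 / a := by
  set F : ℝ → ℝ := (Ioi (0:ℝ)).indicator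
    (fun t => t ^ 1 * Real.exp (-t ^ 3 / 3 + a ^ 2 * t)) with hF
  have hFint : Integrable F :=
    (integrable_indicator_iff measurableSet_Ioi).2 (integrableOn_pow_mul_exp_neg_cube 1 (a ^ 2))
  have hM : cubicMomentReal 1 (a ^ 2) = ∫ s, F (s + a) := by
    rw [integral_add_right_eq_self F a, hF, integral_indicator measurableSet_Ioi]
    rfl
  have hG : Real.sqrt (π * a) = ∫ s : ℝ, a * Real.exp (-a * s ^ 2) := by
    rw [integral_const_mul, integral_gaussian]
    rw [show π * a = a ^ 2 * (π / a) by field_simp, Real.sqrt_mul (sq_nonneg a),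
      Real.sqrt_sq ha.le]
  have hb : 0 < 2 * a / 3 := by positivity
  have hpt : ∀ s : ℝ, |F (s + a) * Real.exp (-(2 / 3) * a ^ 3) - a * Real.exp (-a * s ^ 2)|
      ≤ a / 3 * (|s| ^ 3 * Real.exp (-(2 * a / 3) * s ^ 2))
        + |s| ^ 1 * Real.exp (-(2 * a / 3) * s ^ 2) := by
    intro s
    have hexp : Real.exp (-a * s ^ 2) ≤ Real.exp (-(2 * a / 3) * s ^ 2) :=
      Real.exp_le_exp.2 (by nlinarith [mul_nonneg ha.le (sq_nonneg s)])
    by_cases hs : s + a ∈ Ioi (0:ℝ)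
    · have hs' : 0 < s + a := hs
      have h1 : F (s + a) * Real.exp (-(2 / 3) * a ^ 3)
          = (s + a) * Real.exp (-a * s ^ 2 - s ^ 3 / 3) := by
        rw [hF, indicator_of_mem hs, mul_assoc, ← Real.exp_add, pow_one]
        congr 2
        ring
      have h2 : -a * s ^ 2 - s ^ 3 / 3 ≤ -(2 * a / 3) * s ^ 2 := by
        nlinarith [mul_nonneg hs'.le (sq_nonneg s)]
      have h3 := abs_exp_sub_exp_le (-a * s ^ 2 - s ^ 3 / 3) (-a * s ^ 2) _ h2
        (by nlinarith [mul_nonneg ha.le (sq_nonneg s)])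
      rw [show -a * s ^ 2 - s ^ 3 / 3 - -a * s ^ 2 = -(s ^ 3 / 3) by ring, abs_neg, abs_div,
        abs_pow, abs_of_pos (show (0:ℝ) < 3 by norm_num)] at h3
      rw [h1]
      calc |(s + a) * Real.exp (-a * s ^ 2 - s ^ 3 / 3) - a * Real.exp (-a * s ^ 2)|
          = |a * (Real.exp (-a * s ^ 2 - s ^ 3 / 3) - Real.exp (-a * s ^ 2))
              + s * Real.exp (-a * s ^ 2 - s ^ 3 / 3)| := by ring_nf
        _ ≤ a * |Real.exp (-a * s ^ 2 - s ^ 3 / 3) - Real.exp (-a * s ^ 2)|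
              + |s| * Real.exp (-a * s ^ 2 - s ^ 3 / 3) := by
            refine (abs_add_le _ _).trans ?_
            rw [abs_mul, abs_mul, abs_of_pos ha, abs_of_pos (Real.exp_pos _)]
        _ ≤ a * (|s| ^ 3 / 3 * Real.exp (-(2 * a / 3) * s ^ 2))
              + |s| * Real.exp (-(2 * a / 3) * s ^ 2) := by gcongr
        _ = _ := by ring
    · have hs' : s + a ≤ 0 := not_lt.1 hs
      rw [hF, indicator_of_notMem hs, zero_mul, zero_sub, abs_neg,
        abs_of_pos (by positivity), pow_one]
      have h4 : a ≤ |s| := by linarith [neg_le_abs s]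
      have : 0 ≤ a / 3 * (|s| ^ 3 * Real.exp (-(2 * a / 3) * s ^ 2)) := by positivity
      have h5 : a * Real.exp (-a * s ^ 2) ≤ |s| * Real.exp (-(2 * a / 3) * s ^ 2) := by gcongr
      linarith
  have hi1 : Integrable fun s => F (s + a) * Real.exp (-(2 / 3) * a ^ 3) :=
    (hFint.comp_add_right a).mul_const _
  have hi2 : Integrable fun s : ℝ => a * Real.exp (-a * s ^ 2) :=
    (integrable_exp_neg_mul_sq ha).const_mul a
  have hi3 := (integrable_abs_pow_mul_exp_neg_mul_sq hb 3).const_mul (a / 3)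
  have hi4 := integrable_abs_pow_mul_exp_neg_mul_sq hb 1
  have hle := norm_integral_le_of_norm_le
    (f := fun s => F (s + a) * Real.exp (-(2 / 3) * a ^ 3) - a * Real.exp (-a * s ^ 2))
    (hi3.add hi4) (Eventually.of_forall hpt)
  rw [integral_sub hi1 hi2, integral_mul_const, ← hM, ← hG] at hle
  refine hle.trans (le_of_eq ?_)
  simp only [Pi.add_apply]
  rw [integral_add hi3 hi4, integral_const_mul, integral_abs_pow_mul_exp_neg_mul_sq hb,
    integral_abs_pow_mul_exp_neg_mul_sq hb]
  have g1 : Real.Gamma ((((1:ℕ):ℝ) + 1) / 2) = 1 := by norm_num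
  have g2 : Real.Gamma ((((3:ℕ):ℝ) + 1) / 2) = 1 := by norm_num
  have k1 : -(((1:ℕ):ℝ) + 1) / 2 = -((1:ℕ):ℝ) := by norm_num
  have k2 : -(((3:ℕ):ℝ) + 1) / 2 = -((2:ℕ):ℝ) := by norm_num
  rw [g1, g2, k1, k2, Real.rpow_neg hb.le, Real.rpow_neg hb.le, Real.rpow_natCast,
    Real.rpow_natCast]
  field_simp
  norm_num

lemma nonneg_of_deriv_nonpos_of_tendsto_zero {f f' : ℝ → ℝ} {a₀ : ℝ}
    (hf : ∀ x, a₀ ≤ x → HasDerivAt f (f' x) x) (hf' : ∀ x, a₀ ≤ x → f' x ≤ 0)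
    (hlim : Tendsto f atTop (𝓝 0)) {x : ℝ} (hx : a₀ ≤ x) : 0 ≤ f x := by
  have hanti : AntitoneOn f (Ici a₀) := by
    refine antitoneOn_of_deriv_nonpos (convex_Ici a₀)
      (fun y hy => (hf y hy).continuousAt.continuousWithinAt)
      (fun y hy => (hf y (interior_subset hy)).differentiableAt.differentiableWithinAt)
      (fun y hy => ?_)
    rw [(hf y (interior_subset hy)).deriv]
    exact hf' y (interior_subset hy)
  refine le_of_tendsto hlim ?_
  filter_upwards [eventually_ge_atTop x] with y hy
  exact hanti hx (hx.trans hy) hy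

lemma airyAlpha_mul_cubicMomentReal :
    airyAlpha * cubicMomentReal 1 0 = cubicMomentReal 0 0 := by
  have g2 : Real.Gamma (2 / 3) ≠ 0 := (Real.Gamma_pos_of_pos (by norm_num)).ne'
  have h : (1 / 3 : ℝ) ^ (-(((1:ℕ):ℝ) + 1) / 3)
      = (3:ℝ) ^ ((1:ℝ) / 3) * (1 / 3 : ℝ) ^ (-(((0:ℕ):ℝ) + 1) / 3) := by
    rw [one_div, Real.inv_rpow (by norm_num), Real.inv_rpow (by norm_num),
      ← Real.rpow_neg (by norm_num), ← Real.rpow_neg (by norm_num),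
      ← Real.rpow_add (by norm_num)]
    norm_num
  rw [cubicMomentReal, cubicMomentReal, integral_pow_mul_exp_neg_cube,
    integral_pow_mul_exp_neg_cube, airyAlpha, h]
  have h3 : (3:ℝ) ^ ((1:ℝ) / 3) ≠ 0 := by positivity
  norm_num
  norm_num at h3
  field_simp

lemma airyAlpha_pos : 0 < airyAlpha := by
  have g1 := Real.Gamma_pos_of_pos (s := 1 / 3) (by norm_num)
  have g2 := Real.Gamma_pos_of_pos (s := 2 / 3) (by norm_num)
  rw [airyAlpha]
  positivity

lemma cubicMomentReal_zero_mul_one :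
    9 * (cubicMomentReal 0 0 * cubicMomentReal 1 0) = 2 * π * Real.sqrt 3 := by
  have hs : Real.sqrt 3 * Real.sqrt 3 = 3 := Real.mul_self_sqrt (by norm_num)
  have hs0 : Real.sqrt 3 ≠ 0 := by positivity
  have hr := Real.Gamma_mul_Gamma_one_sub (1 / 3)
  rw [show (1:ℝ) - 1 / 3 = 2 / 3 by norm_num, show π * (1 / 3) = π / 3 by ring,
    Real.sin_pi_div_three] at hr
  have h : (1 / 3 : ℝ) ^ (-(((0:ℕ):ℝ) + 1) / 3) * (1 / 3 : ℝ) ^ (-(((1:ℕ):ℝ) + 1) / 3)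
      = 3 := by
    rw [← Real.rpow_add (by norm_num)]
    norm_num [Real.rpow_neg_one]
  rw [cubicMomentReal, cubicMomentReal, integral_pow_mul_exp_neg_cube,
    integral_pow_mul_exp_neg_cube]
  have e0 : (((0:ℕ):ℝ) + 1) / 3 = 1 / 3 := by norm_num
  have e1 : (((1:ℕ):ℝ) + 1) / 3 = 2 / 3 := by norm_num
  rw [e0, e1]
  have h2 : π / (Real.sqrt 3 / 2) = 2 * π * Real.sqrt 3 / 3 := by
    field_simp
    linarith
  rw [h2] at hr
  linear_combination (Real.Gamma (1 / 3) * Real.Gamma (2 / 3)) * h + 3 * hr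

lemma sqrt_three_mul_airyAlpha :
    Real.sqrt 3 * airyAlpha = (3 * cubicMomentReal 0 0) ^ 2 / (2 * π) := by
  have h1 := airyAlpha_mul_cubicMomentReal
  have h2 := cubicMomentReal_zero_mul_one
  rw [eq_div_iff (by positivity)]
  linear_combination (-airyAlpha) * h2 + 9 * cubicMomentReal 0 0 * h1

lemma airy_deriv_growth {u v u' v' : ℝ → ℝ}
    (hu : ∀ x, HasDerivAt u (u' x) x) (huAiry : ∀ x, HasDerivAt u' (x * u x) x)
    (hv : ∀ x, HasDerivAt v (v' x) x) (hvAiry : ∀ x, HasDerivAt v' (x * v x) x)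
    (hu0 : u 0 = 1) (hu'0 : u' 0 = 0) (hv0 : v 0 = 0) (hv'0 : v' 0 = 1) :
    ∃ C : ℝ, 0 < C ∧ ∀ a : ℝ, 1 ≤ a → ∃ ε : ℝ, |ε| ≤ C / a ∧
      3 * cubicMomentReal 0 0 * u' (a ^ 2)
        = Real.sqrt (π * a) * Real.exp ((2 / 3) * a ^ 3) * (1 + ε) := by
  have hq := cubicMomentReal_zero_pos 1
  refine ⟨3 * cubicMomentReal 1 0 + 9 / 4, by positivity, fun a ha => ?_⟩
  have ha0 : 0 < a := by linarith
  have h1 := (cubicMoment_airy hu huAiry hv hvAiry hu0 hu'0 hv0 hv'0 (sq_nonneg a)).1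
  have h2 := abs_cubicMomentReal_one_sub_le ha0
  set e := Real.exp ((2 / 3) * a ^ 3) with he
  have hepos : 0 < e := Real.exp_pos _
  have hem : Real.exp (-(2 / 3) * a ^ 3) = e⁻¹ := by rw [he, ← Real.exp_neg]; ring_nf
  rw [hem] at h2
  have hsqrt : 1 ≤ Real.sqrt (π * a) := by
    rw [Real.one_le_sqrt]
    nlinarith [Real.pi_gt_three]
  set S := Real.sqrt (π * a)
  have hea : a ≤ 3 / 2 * e := by
    have h3 := Real.add_one_le_exp ((2 / 3) * a ^ 3)
    have h4 : a ≤ a ^ 3 := le_self_pow₀ ha (by norm_num)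
    linarith
  have h5 : |cubicMomentReal 1 (a ^ 2) - S * e| ≤ 9 / 4 / a * e := by
    have : cubicMomentReal 1 (a ^ 2) - S * e = (cubicMomentReal 1 (a ^ 2) * e⁻¹ - S) * e := by
      field_simp
    rw [this, abs_mul, abs_of_pos hepos]
    gcongr
  have h6 : |3 * cubicMomentReal 0 0 * u' (a ^ 2) - S * e|
      ≤ (3 * cubicMomentReal 1 0 + 9 / 4) / a * e := by
    refine (abs_sub_le _ (cubicMomentReal 1 (a ^ 2)) _).trans ((add_le_add h1 h5).trans ?_)
    have : 2 * cubicMomentReal 1 0 ≤ 3 * cubicMomentReal 1 0 / a * e := by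
      rw [div_mul_eq_mul_div, le_div_iff₀ ha0]
      nlinarith
    rw [add_div, add_mul]
    linarith
  refine ⟨(3 * cubicMomentReal 0 0 * u' (a ^ 2) - S * e) / (S * e), ?_, by field_simp; ring⟩
  rw [abs_div, abs_of_pos (show 0 < S * e by positivity), div_le_iff₀ (by positivity)]
  refine h6.trans ?_
  have : e ≤ S * e := le_mul_of_one_le_left hepos.le hsqrt
  gcongr

lemma abs_inv_one_add_sq_sub_one_le {ε : ℝ} (h : |ε| ≤ 1 / 2) :
    |1 / (1 + ε) ^ 2 - 1| ≤ 10 * |ε| := by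
  have h' := abs_le.1 h
  have h1 : (1 / 4 : ℝ) ≤ (1 + ε) ^ 2 := by nlinarith
  have h2 : 1 / (1 + ε) ^ 2 - 1 = -(ε * (2 + ε)) / (1 + ε) ^ 2 := by
    have : (1 + ε) ^ 2 ≠ 0 := by positivity
    rw [div_sub_one this]
    congr 1
    ring
  rw [h2, abs_div, abs_neg, abs_mul, abs_of_pos (show 0 < (1 + ε) ^ 2 by linarith),
    abs_of_pos (show 0 < 2 + ε by linarith), div_le_iff₀ (by linarith)]
  nlinarith [abs_nonneg ε, mul_nonneg (abs_nonneg ε) (by linarith : 0 ≤ (1 + ε) ^ 2 - 1 / 4)]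

/-- Asymptotics of the ratio of the recessive to the dominant Airy derivative. -/
lemma airy_recessive_ratio {u v u' v' : ℝ → ℝ}
    (hu : ∀ x, HasDerivAt u (u' x) x) (huAiry : ∀ x, HasDerivAt u' (x * u x) x)
    (hv : ∀ x, HasDerivAt v (v' x) x) (hvAiry : ∀ x, HasDerivAt v' (x * v x) x)
    (hu0 : u 0 = 1) (hu'0 : u' 0 = 0) (hv0 : v 0 = 0) (hv'0 : v' 0 = 1) :
    ∃ M a₀ : ℝ, 0 < M ∧ 1 ≤ a₀ ∧ ∀ a : ℝ, a₀ ≤ a → u' (a ^ 2) ≠ 0 ∧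
      |airyAlpha - v' (a ^ 2) / u' (a ^ 2)
          + Real.sqrt 3 * airyAlpha * Real.exp (-(4 / 3) * a ^ 3)|
        ≤ M / a * Real.exp (-(4 / 3) * a ^ 3) := by
  obtain ⟨C, hC, hgrow⟩ := airy_deriv_growth hu huAiry hv hvAiry hu0 hu'0 hv0 hv'0
  have hp := cubicMomentReal_zero_pos 0
  have hq := cubicMomentReal_zero_pos 1
  have hκ : 0 < Real.sqrt 3 * airyAlpha := mul_pos (by positivity) airyAlpha_pos
  have hκeq := sqrt_three_mul_airyAlpha
  have hαp := airyAlpha_mul_cubicMomentReal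
  set κ := Real.sqrt 3 * airyAlpha
  set P := 3 * cubicMomentReal 0 0 with hP
  have hPpos : 0 < P := by positivity
  have hwr : ∀ x, u x * v' x - u' x * v x = 1 := fun x => by
    rw [airy_wronskian_eq hu huAiry hv hvAiry x, hu0, hu'0, hv0, hv'0]
    norm_num
  have hgrow' : ∀ a, max 1 (2 * C) ≤ a → 1 ≤ a ∧ 0 < u' (a ^ 2) ∧ ∃ ε : ℝ, |ε| ≤ C / a ∧
      |ε| ≤ 1 / 2 ∧ P * u' (a ^ 2)
        = Real.sqrt (π * a) * Real.exp ((2 / 3) * a ^ 3) * (1 + ε) := by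
    intro a ha
    have ha1 : 1 ≤ a := (le_max_left _ _).trans ha
    have ha2 : 2 * C ≤ a := (le_max_right _ _).trans ha
    have ha0 : 0 < a := by linarith
    obtain ⟨ε, hε, h⟩ := hgrow a ha1
    have hε2 : |ε| ≤ 1 / 2 := hε.trans (by rw [div_le_iff₀ ha0]; linarith)
    have h1ε : 0 < 1 + ε := by linarith [neg_le_of_abs_le hε2]
    have : 0 < P * u' (a ^ 2) := by rw [h]; positivity
    exact ⟨ha1, pos_of_mul_pos_right this hPpos.le, ε, hε, hε2, h⟩
  have hgauss : ∀ a : ℝ, HasDerivAt (fun a => Real.exp (-(4 / 3) * a ^ 3))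
      (-(4 * a ^ 2) * Real.exp (-(4 / 3) * a ^ 3)) a := fun a =>
    (((hasDerivAt_pow 3 a).const_mul (-(4 / 3))).exp).congr_deriv (by push_cast; ring)
  have hDderiv : ∀ a, max 1 (2 * C) ≤ a → HasDerivAt
      (fun a => airyAlpha - v' (a ^ 2) / u' (a ^ 2)) (2 * a ^ 3 / u' (a ^ 2) ^ 2) a := by
    intro a ha
    have hpos := (hgrow' a ha).2.1
    have hsq : HasDerivAt (fun a : ℝ => a ^ 2) (2 * a) a := by simpa using hasDerivAt_pow 2 a
    refine ((((hvAiry (a ^ 2)).comp a hsq).div ((huAiry (a ^ 2)).comp a hsq)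
      hpos.ne').const_sub airyAlpha).congr_deriv ?_
    have := hwr (a ^ 2)
    simp only [Function.comp]
    rw [← neg_div]
    congr 1
    linear_combination (2 * a ^ 3) * this
  have hbound : ∀ a, max 1 (2 * C) ≤ a →
      |2 * a ^ 3 / u' (a ^ 2) ^ 2 - 4 * κ * a ^ 2 * Real.exp (-(4 / 3) * a ^ 3)|
        ≤ 40 * κ * C * a * Real.exp (-(4 / 3) * a ^ 3) := by
    intro a ha
    obtain ⟨ha1, hpos, ε, hε, hε2, h⟩ := hgrow' a ha
    have ha0 : 0 < a := by linarith
    have h1ε : 0 < 1 + ε := by linarith [neg_le_of_abs_le hε2]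
    have hE : Real.exp (-(4 / 3) * a ^ 3) * Real.exp ((2 / 3) * a ^ 3) ^ 2 = 1 := by
      rw [← Real.exp_nat_mul, ← Real.exp_add, Real.exp_eq_one_iff]
      push_cast
      ring
    have hS : Real.sqrt (π * a) ^ 2 = π * a := Real.sq_sqrt (by positivity)
    have hsq : P ^ 2 * u' (a ^ 2) ^ 2 * Real.exp (-(4 / 3) * a ^ 3) = π * a * (1 + ε) ^ 2 := by
      rw [← mul_pow, h, mul_pow, mul_pow, hS]
      linear_combination (π * a * (1 + ε) ^ 2) * hE
    have key : 2 * a ^ 3 / u' (a ^ 2) ^ 2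
        = 4 * κ * a ^ 2 * Real.exp (-(4 / 3) * a ^ 3) * (1 / (1 + ε) ^ 2) := by
      rw [hκeq]
      have hπ := Real.pi_pos
      generalize Real.exp (-(4 / 3) * a ^ 3) = e at hsq ⊢
      field_simp
      linear_combination (-4) * hsq
    rw [key, ← mul_sub_one, abs_mul, abs_of_pos (by positivity)]
    calc _ ≤ 4 * κ * a ^ 2 * Real.exp (-(4 / 3) * a ^ 3) * (10 * (C / a)) := by
          gcongr
          exact (abs_inv_one_add_sq_sub_one_le hε2).trans (by gcongr)
      _ = _ := by field_simp; ring
  have hexp0 : Tendsto (fun a : ℝ => Real.exp (-(4 / 3) * a ^ 3)) atTop (𝓝 0) := by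
    refine Real.tendsto_exp_atBot.comp ?_
    exact (tendsto_pow_atTop (by norm_num)).const_mul_atTop_of_neg (by norm_num)
  have hinv : Tendsto (fun a : ℝ => a⁻¹) atTop (𝓝 0) := tendsto_inv_atTop_zero
  have hD0 : Tendsto (fun a => airyAlpha - v' (a ^ 2) / u' (a ^ 2)) atTop (𝓝 0) := by
    have hz : Tendsto (fun a : ℝ => 4 * P * a⁻¹) atTop (𝓝 0) := by
      simpa using hinv.const_mul (4 * P)
    refine squeeze_zero_norm' ?_ hz
    filter_upwards [eventually_ge_atTop (max 1 (2 * C))] with a ha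
    obtain ⟨ha1, hpos, ε, hε, hε2, h⟩ := hgrow' a ha
    have ha0 : 0 < a := by linarith
    have h1 := (cubicMoment_airy hu huAiry hv hvAiry hu0 hu'0 hv0 hv'0 (sq_nonneg a)).2
    rw [← hαp, show 3 * (airyAlpha * cubicMomentReal 1 0) * u' (a ^ 2)
        - 3 * cubicMomentReal 1 0 * v' (a ^ 2)
        = 3 * cubicMomentReal 1 0 * (airyAlpha * u' (a ^ 2) - v' (a ^ 2)) by ring, abs_mul,
      abs_of_pos (show 0 < 3 * cubicMomentReal 1 0 by positivity)] at h1
    have h2 : |airyAlpha * u' (a ^ 2) - v' (a ^ 2)| ≤ 4 / 3 := by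
      by_contra! hcon
      nlinarith
    have h3 : a ≤ 3 * (P * u' (a ^ 2)) := by
      have e1 := Real.add_one_le_exp ((2 / 3) * a ^ 3)
      have e2 : a ≤ a ^ 3 := le_self_pow₀ ha1 (by norm_num)
      have e3 : 1 / 2 ≤ 1 + ε := by linarith [neg_le_of_abs_le hε2]
      have e4 : 1 ≤ Real.sqrt (π * a) := by
        rw [Real.one_le_sqrt]
        nlinarith [Real.pi_gt_three]
      rw [h]
      calc a ≤ 3 * (1 * (2 / 3 * a) * (1 / 2)) := by linarith
        _ ≤ _ := by
          gcongr
          linarith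
    have h4 : airyAlpha - v' (a ^ 2) / u' (a ^ 2)
        = (airyAlpha * u' (a ^ 2) - v' (a ^ 2)) / u' (a ^ 2) := by field_simp
    rw [Real.norm_eq_abs, h4, abs_div, abs_of_pos hpos, div_le_iff₀ hpos]
    refine h2.trans ?_
    have : 4 * P * a⁻¹ * u' (a ^ 2) = 4 / 3 * (3 * (P * u' (a ^ 2)) / a) := by field_simp
    rw [this]
    have : 1 ≤ 3 * (P * u' (a ^ 2)) / a := by rwa [le_div_iff₀ ha0, one_mul]
    linarith
  set M := 10 * κ * C with hM
  have hMpos : 0 < M := by positivity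
  have hGderiv : ∀ a : ℝ, 0 < a → HasDerivAt (fun a => M * a⁻¹ * Real.exp (-(4 / 3) * a ^ 3))
      (-(M / a ^ 2 + 4 * M * a) * Real.exp (-(4 / 3) * a ^ 3)) a := fun a ha =>
    (((hasDerivAt_inv ha.ne').const_mul M).mul (hgauss a)).congr_deriv (by field_simp; ring)
  have hG0 : Tendsto (fun a : ℝ => M * a⁻¹ * Real.exp (-(4 / 3) * a ^ 3)) atTop (𝓝 0) := by
    simpa using (hinv.const_mul M).mul hexp0
  have hsum0 := hD0.add (hexp0.const_mul κ)
  simp only [mul_zero, add_zero] at hsum0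
  have hsumd := fun a ha => (hDderiv a ha).add ((hgauss a).const_mul κ)
  refine ⟨M, max 1 (2 * C), hMpos, le_max_left _ _, fun a ha => ⟨(hgrow' a ha).2.1.ne', ?_⟩⟩
  have hGneg : ∀ x, max 1 (2 * C) ≤ x → 0 < x ∧
      0 ≤ M / x ^ 2 * Real.exp (-(4 / 3) * x ^ 3) := fun x hx =>
    ⟨by linarith [(hgrow' x hx).1], by positivity⟩
  have h1 := nonneg_of_deriv_nonpos_of_tendsto_zero
    (fun x hx => (hsumd x hx).add (hGderiv x (hGneg x hx).1))
    (fun x hx => by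
      have h1 := abs_le.1 (hbound x hx)
      have h2 := (hGneg x hx).2
      rw [hM] at h2 ⊢
      linarith [h1.2])
    (by
      have h := hsum0.add hG0
      rwa [add_zero] at h) ha
  have h2 := nonneg_of_deriv_nonpos_of_tendsto_zero
    (fun x hx => (hsumd x hx).neg.add (hGderiv x (hGneg x hx).1))
    (fun x hx => by
      have h1 := abs_le.1 (hbound x hx)
      have h2 := (hGneg x hx).2
      rw [hM] at h2 ⊢
      linarith [h1.1])
    (by
      have h := hsum0.neg.add hG0
      rwa [neg_zero, add_zero] at h) ha
  simp only [Pi.add_apply, Pi.neg_apply] at h1 h2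
  rw [abs_le, div_eq_mul_inv]
  constructor <;> linarith

lemma exists_abs_sub_le_mul {f f' : ℝ → ℝ} (hf : ∀ x, HasDerivAt f (f' x) x)
    (hf' : Continuous f') (l r : ℝ) :
    ∃ L : ℝ, 0 ≤ L ∧ ∀ x ∈ Icc l r, |f x - f l| ≤ L * (x - l) := by
  obtain ⟨L, hL⟩ := isCompact_Icc.exists_bound_of_continuousOn (s := Icc l r) hf'.continuousOn
  refine ⟨max L 0, le_max_right _ _, fun x hx => ?_⟩
  have h := (convex_Icc l r).norm_image_sub_le_of_norm_hasDerivWithin_le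
    (fun y _ => (hf y).hasDerivWithinAt)
    (fun y hy => (hL y hy).trans (le_max_left L 0)) (left_mem_Icc.2 (hx.1.trans hx.2)) hx
  rwa [Real.norm_eq_abs, Real.norm_eq_abs, abs_of_nonneg (sub_nonneg.2 hx.1)] at h

lemma exists_abs_sub_sub_le_mul_sq {f f' f'' : ℝ → ℝ} (hf : ∀ x, HasDerivAt f (f' x) x)
    (hf' : ∀ x, HasDerivAt f' (f'' x) x) (hf'' : Continuous f'') (l r : ℝ) :
    ∃ L : ℝ, 0 ≤ L ∧ ∀ x ∈ Icc l r, |f x - f l - f' l * (x - l)| ≤ L * (x - l) ^ 2 := by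
  obtain ⟨L, hL0, hL⟩ := exists_abs_sub_le_mul hf' hf'' l r
  refine ⟨L, hL0, fun x hx => ?_⟩
  have hd : ∀ y, HasDerivAt (fun y => f y - f' l * y) (f' y - f' l) y := fun y =>
    ((hf y).sub ((hasDerivAt_id y).const_mul (f' l))).congr_deriv (by ring)
  have h := (convex_Icc l x).norm_image_sub_le_of_norm_hasDerivWithin_le
    (C := L * (x - l)) (fun y _ => (hd y).hasDerivWithinAt)
    (fun y hy => (hL y ⟨hy.1, hy.2.trans hx.2⟩).trans
      (mul_le_mul_of_nonneg_left (by linarith [hy.2]) hL0))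
    (left_mem_Icc.2 hx.1) (right_mem_Icc.2 hx.1)
  rw [Real.norm_eq_abs, Real.norm_eq_abs, abs_of_nonneg (sub_nonneg.2 hx.1)] at h
  calc |f x - f l - f' l * (x - l)| = |f x - f' l * x - (f l - f' l * l)| := by ring_nf
    _ ≤ _ := h
    _ = _ := by ring

lemma exists_le_mul_abs_of_simple_zero {f f' : ℝ → ℝ} {l r : ℝ}
    (hf : ∀ x, HasDerivAt f (f' x) x) (hl : f l = 0) (hl' : f' l ≠ 0)
    (hne : ∀ x, l < x → f x ≠ 0) (hlr : l ≤ r) :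
    ∃ B : ℝ, 0 < B ∧ ∀ x ∈ Icc l r, x - l ≤ B * |f x| := by
  have hcont : Continuous (dslope f l) := by
    refine continuous_iff_continuousAt.2 fun x => ?_
    rcases eq_or_ne x l with rfl | hx
    · exact continuousAt_dslope_same.2 (hf x).differentiableAt
    · exact (continuousAt_dslope_of_ne hx).2 (hf x).continuousAt
  obtain ⟨x₀, hx₀, hmin⟩ := isCompact_Icc.exists_isMinOn (nonempty_Icc.2 hlr)
    (hcont.abs.continuousOn (s := Icc l r))
  have hval : ∀ x, f x = (x - l) * dslope f l x := fun x => by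
    have := sub_smul_dslope f l x
    rw [hl, sub_zero, smul_eq_mul] at this
    exact this.symm
  have hpos : 0 < |dslope f l x₀| := by
    rw [abs_pos]
    rcases eq_or_lt_of_le hx₀.1 with h | h
    · rw [← h, dslope_same, (hf l).deriv]
      exact hl'
    · intro h0
      exact hne x₀ h (by rw [hval, h0, mul_zero])
  refine ⟨|dslope f l x₀|⁻¹, inv_pos.2 hpos, fun x hx => ?_⟩
  have h1 : |dslope f l x₀| ≤ |dslope f l x| := hmin hx
  rw [hval x, abs_mul, abs_of_nonneg (sub_nonneg.2 hx.1), inv_mul_eq_div, le_div_iff₀ hpos]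
  exact mul_le_mul_of_nonneg_left h1 (sub_nonneg.2 hx.1)

/-- Linearization of the matching condition at a simple zero. -/
lemma abs_shift_add_le {t δ B R w U U₁ : ℝ} (ht : 0 < t) (hδ0 : 0 ≤ δ) (hB : 0 < B)
    (hδ : δ ≤ B * |w|) (hw : w = U * R) (hU : |U| ≤ B) (hlin : |U₁ * w + t * δ| ≤ B * δ ^ 2)
    (hlip : |U - U₁| ≤ B * δ) :
    |δ + U₁ ^ 2 / t * R| ≤ (B ^ 5 + |U₁| * B ^ 3) / t * R ^ 2 := by
  have h1 : δ ≤ B ^ 2 * |R| := by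
    rw [hw, abs_mul] at hδ
    calc δ ≤ B * (|U| * |R|) := hδ
      _ ≤ B * (B * |R|) := by gcongr
      _ = _ := by ring
  have h2 : δ + U₁ ^ 2 / t * R = ((U₁ * w + t * δ) - U₁ * (U - U₁) * R) / t := by
    rw [hw]
    field_simp
    ring
  rw [h2, abs_div, abs_of_pos ht, div_mul_eq_mul_div]
  gcongr
  calc |U₁ * w + t * δ - U₁ * (U - U₁) * R|
      ≤ |U₁ * w + t * δ| + |U₁| * |U - U₁| * |R| := by
        rw [← abs_mul, ← abs_mul]
        exact abs_sub _ _
    _ ≤ B * (B ^ 2 * |R|) ^ 2 + |U₁| * (B * (B ^ 2 * |R|)) * |R| := by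
        gcongr
        · exact hlin.trans (by gcongr)
        · exact hlip.trans (by gcongr)
    _ = (B ^ 5 + |U₁| * B ^ 3) * |R| ^ 2 := by ring
    _ = _ := by rw [sq_abs]

lemma AiD_eq_mul (u' v' : ℝ → ℝ) (x : ℝ) :
    AiD u' v' x = 1 / ((3:ℝ) ^ ((1:ℝ)/3) * Real.Gamma (1/3)) * (airyAlpha * u' x - v' x) := by
  have g1 := Real.Gamma_pos_of_pos (s := 1 / 3) (by norm_num)
  have g2 := Real.Gamma_pos_of_pos (s := 2 / 3) (by norm_num)
  have h : (3:ℝ) ^ ((2:ℝ)/3) = (3:ℝ) ^ ((1:ℝ)/3) * (3:ℝ) ^ ((1:ℝ)/3) := by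
    rw [← Real.rpow_add (by norm_num)]
    norm_num
  have h3 : (0:ℝ) < (3:ℝ) ^ ((1:ℝ)/3) := by positivity
  rw [AiD, airyAlpha, h]
  field_simp

lemma airy_shift_asymptotics {u v u' v' : ℝ → ℝ}
    (hu : ∀ x, HasDerivAt u (u' x) x) (huAiry : ∀ x, HasDerivAt u' (x * u x) x)
    (hv : ∀ x, HasDerivAt v (v' x) x) (hvAiry : ∀ x, HasDerivAt v' (x * v x) x)
    (hu0 : u 0 = 1) (hu'0 : u' 0 = 0) (hv0 : v 0 = 0) (hv'0 : v' 0 = 1)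
    {t : ℝ} (ht : 0 < t) (hz : AiD u' v' (-t) = 0) (hne : ∀ x : ℝ, -t < x → AiD u' v' x ≠ 0) :
    ∃ C a₀ : ℝ, 0 < C ∧ 1 ≤ a₀ ∧ ∀ a : ℝ, a₀ ≤ a → ∀ y ∈ Icc (-t) 0,
      u' y * v' (a ^ 2) = v' y * u' (a ^ 2) →
      |y + t - Real.sqrt 3 * airyAlpha * (u' (-t)) ^ 2 / t * Real.exp (-(4 / 3) * a ^ 3)|
        ≤ C / a * Real.exp (-(4 / 3) * a ^ 3) := by
  obtain ⟨M, a₀, hM, ha₀, hratio⟩ :=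
    airy_recessive_ratio hu huAiry hv hvAiry hu0 hu'0 hv0 hv'0
  have hκ : 0 < Real.sqrt 3 * airyAlpha := mul_pos (by positivity) airyAlpha_pos
  set κ := Real.sqrt 3 * airyAlpha
  have hb : 1 / ((3:ℝ) ^ ((1:ℝ)/3) * Real.Gamma (1/3)) ≠ 0 := by
    have g1 := Real.Gamma_pos_of_pos (s := 1 / 3) (by norm_num)
    positivity
  set w := fun x => airyAlpha * u x - v x with hwdef
  set w' := fun x => airyAlpha * u' x - v' x with hw'def
  have hw : ∀ x, HasDerivAt w (w' x) x := fun x => ((hu x).const_mul _).sub (hv x)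
  have hw' : ∀ x, HasDerivAt w' (x * w x) x := fun x =>
    (((huAiry x).const_mul _).sub (hvAiry x)).congr_deriv (by simp only [hwdef]; ring)
  have hwz : w' (-t) = 0 := by
    rw [AiD_eq_mul] at hz
    exact (mul_eq_zero.1 hz).resolve_left hb
  have hwne : ∀ x, -t < x → w' x ≠ 0 := fun x hx h0 => hne x hx (by
    rw [AiD_eq_mul]
    exact mul_eq_zero_of_right _ h0)
  have hwr : u' (-t) * w (-t) = 1 := by
    have h := airy_wronskian_eq hu huAiry hw hw' (-t)
    rw [hwz, hu0, hu'0] at h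
    simp only [hw'def, hu'0, hv'0] at h
    linarith
  have hwt : w (-t) ≠ 0 := right_ne_zero_of_mul_eq_one hwr
  have hcu : Continuous u := continuous_iff_continuousAt.2 fun x => (hu x).continuousAt
  have hcu' : Continuous u' := continuous_iff_continuousAt.2 fun x => (huAiry x).continuousAt
  have hcw : Continuous w := continuous_iff_continuousAt.2 fun x => (hw x).continuousAt
  have hcw' : Continuous w' := continuous_iff_continuousAt.2 fun x => (hw' x).continuousAt
  have hlr : -t ≤ 0 := by linarith
  obtain ⟨B₁, hB₁, h₁⟩ := exists_le_mul_abs_of_simple_zero hw' hwz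
    (mul_ne_zero (by linarith : -t ≠ 0) hwt) hwne hlr
  obtain ⟨B₂, h₂⟩ := isCompact_Icc.exists_bound_of_continuousOn (s := Icc (-t) 0)
    hcu'.continuousOn
  obtain ⟨B₃, hB₃, h₃⟩ := exists_abs_sub_sub_le_mul_sq hw' (f'' := fun x => w x + x * w' x)
    (fun x => ((hasDerivAt_id x).mul (hw x)).congr_deriv (by simp))
    (by fun_prop) (-t) 0
  obtain ⟨B₄, hB₄, h₄⟩ := exists_abs_sub_le_mul huAiry (by fun_prop) (-t) 0
  set U₁ := u' (-t) with hU₁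
  set B := B₁ + |B₂| + |U₁| * B₃ + B₄ with hB
  have hU3 : 0 ≤ |U₁| * B₃ := by positivity
  have hBpos : 0 < B := by positivity
  set K := (B ^ 5 + |U₁| * B ^ 3) / t with hK
  have hKpos : 0 < K := by positivity
  refine ⟨K * (κ + M) ^ 2 + U₁ ^ 2 / t * M, a₀, by positivity, ha₀, fun a ha y hy heq => ?_⟩
  obtain ⟨hune, hR⟩ := hratio a ha
  have ha1 : 1 ≤ a := ha₀.trans ha
  have ha0 : 0 < a := by linarith
  set R := airyAlpha - v' (a ^ 2) / u' (a ^ 2) with hRdef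
  set e := Real.exp (-(4 / 3) * a ^ 3) with he
  have hepos : 0 < e := Real.exp_pos _
  have hδ0 : 0 ≤ y + t := by linarith [hy.1]
  have hwy : w' y = u' y * R := by
    simp only [hw'def, hRdef]
    field_simp
    linear_combination heq
  have hshift := abs_shift_add_le (t := t) (δ := y + t) (B := B) (R := R) (w := w' y)
    (U := u' y) (U₁ := U₁) ht hδ0 hBpos
    (by
      have h := h₁ y hy
      rw [sub_neg_eq_add] at h
      exact h.trans (mul_le_mul_of_nonneg_right
        (by rw [hB]; linarith [abs_nonneg B₂]) (abs_nonneg _)))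
    hwy
    ((h₂ y hy).trans (by rw [hB]; linarith [le_abs_self B₂]))
    (by
      have h := h₃ y hy
      rw [sub_neg_eq_add, hwz, sub_zero] at h
      have e1 : U₁ * w' y + t * (y + t) = U₁ * (w' y - -t * w (-t) * (y + t)) := by
        linear_combination (-t * (y + t)) * hwr
      rw [e1, abs_mul]
      calc _ ≤ |U₁| * (B₃ * (y + t) ^ 2) := by gcongr
        _ = |U₁| * B₃ * (y + t) ^ 2 := by ring
        _ ≤ _ := by
          gcongr
          rw [hB]
          linarith [abs_nonneg B₂])
    (by
      have h := h₄ y hy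
      rw [sub_neg_eq_add] at h
      exact h.trans (mul_le_mul_of_nonneg_right
        (by rw [hB]; linarith [abs_nonneg B₂]) hδ0))
  have hRle : |R| ≤ (κ + M) * e := by
    have h1 : |R| ≤ |R + κ * e| + |κ * e| := by
      have := abs_sub (R + κ * e) (κ * e)
      rwa [add_sub_cancel_right] at this
    rw [abs_of_pos (show 0 < κ * e by positivity)] at h1
    have h2 : M / a * e ≤ M * e := by
      gcongr
      exact div_le_self hM.le ha1
    linarith
  have hea : e ≤ 1 / a := by
    have h1 := Real.add_one_le_exp ((4 / 3) * a ^ 3)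
    have h2 : a ≤ a ^ 3 := le_self_pow₀ ha1 (by norm_num)
    rw [he, neg_mul, Real.exp_neg, ← one_div]
    gcongr
    linarith
  have hR2 : R ^ 2 ≤ (κ + M) ^ 2 / a * e := by
    calc R ^ 2 = |R| ^ 2 := (sq_abs R).symm
      _ ≤ ((κ + M) * e) ^ 2 := by gcongr
      _ = (κ + M) ^ 2 * e * e := by ring
      _ ≤ (κ + M) ^ 2 * (1 / a) * e := by gcongr
      _ = _ := by ring
  have hsplit : y + t - κ * U₁ ^ 2 / t * e
      = (y + t + U₁ ^ 2 / t * R) - U₁ ^ 2 / t * (R + κ * e) := by ring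
  rw [hsplit]
  calc _ ≤ |y + t + U₁ ^ 2 / t * R| + U₁ ^ 2 / t * |R + κ * e| := by
        refine (abs_sub _ _).trans (le_of_eq ?_)
        rw [abs_mul, abs_of_nonneg (show 0 ≤ U₁ ^ 2 / t by positivity)]
    _ ≤ K * ((κ + M) ^ 2 / a * e) + U₁ ^ 2 / t * (M / a * e) := by
        gcongr
        exact hshift.trans (by gcongr)
    _ = _ := by ring

lemma abs_exp_cube_shift_le {a b t δ : ℝ} (ha : 0 < a) (hb : 0 < b)
    (hδ0 : 0 ≤ δ) (hδ : δ ≤ t) (hab : a ^ 2 = b ^ 2 - t + δ) :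
    Real.exp (-(4 / 3) * a ^ 3) ≤ Real.exp (-(4 / 3) * b ^ 3 + 2 * t * b) ∧
    |Real.exp (-(4 / 3) * a ^ 3) - Real.exp (-(4 / 3) * b ^ 3 + 2 * t * b)|
      ≤ (2 * b * δ + 4 / 3 * t ^ 2 / b) * Real.exp (-(4 / 3) * b ^ 3 + 2 * t * b) := by
  have hle : a ≤ b := (sq_le_sq₀ ha.le hb.le).1 (by linarith)
  have hdiff : -(4 / 3) * a ^ 3 - (-(4 / 3) * b ^ 3 + 2 * t * b)
      = -(2 * b * δ + 4 / 3 * ((b - a) ^ 2 * (a + b / 2))) := by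
    linear_combination (-2 * b) * hab
  have h1 : (b - a) * (b + a) ≤ t := by nlinarith
  have ht : 0 ≤ t := hδ0.trans hδ
  have h2 : (b - a) ≤ t / b := by
    rw [le_div_iff₀ hb]
    nlinarith [mul_nonneg (sub_nonneg.2 hle) ha.le]
  have h3 : (b - a) ^ 2 * (a + b / 2) ≤ t ^ 2 / b := by
    calc (b - a) ^ 2 * (a + b / 2) ≤ (b - a) ^ 2 * (b + a) :=
          mul_le_mul_of_nonneg_left (by linarith) (sq_nonneg _)
      _ = (b - a) * ((b - a) * (b + a)) := by ring
      _ ≤ t / b * t := by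
        have := sub_nonneg.2 hle
        gcongr
      _ = _ := by ring
  have h4 : 0 ≤ 2 * b * δ + 4 / 3 * ((b - a) ^ 2 * (a + b / 2)) := by positivity
  have h5 : -(4 / 3) * a ^ 3 ≤ -(4 / 3) * b ^ 3 + 2 * t * b := by linarith
  refine ⟨Real.exp_le_exp.2 h5, (abs_exp_sub_exp_le _ _ _ h5 le_rfl).trans ?_⟩
  rw [hdiff, abs_neg, abs_of_nonneg h4]
  gcongr
  rw [mul_div_assoc]
  gcongr

lemma airy_ground_state_asymptotics {u v u' v' : ℝ → ℝ}
    (hu : ∀ x, HasDerivAt u (u' x) x) (huAiry : ∀ x, HasDerivAt u' (x * u x) x)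
    (hv : ∀ x, HasDerivAt v (v' x) x) (hvAiry : ∀ x, HasDerivAt v' (x * v x) x)
    (hu0 : u 0 = 1) (hu'0 : u' 0 = 0) (hv0 : v 0 = 0) (hv'0 : v' 0 = 1)
    {t : ℝ} (ht : 0 < t) (hz : AiD u' v' (-t) = 0) (hne : ∀ x : ℝ, -t < x → AiD u' v' x ≠ 0) :
    ∃ C : ℝ, 0 < C ∧ ∀ b : ℝ, 0 < b → ∀ y ∈ Icc (-t) 0,
      u' y * v' (b ^ 2 + y) = v' y * u' (b ^ 2 + y) →
      |y + t - Real.sqrt 3 * airyAlpha * (u' (-t)) ^ 2 / t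
          * Real.exp (-(4 / 3) * b ^ 3 + 2 * t * b)|
        ≤ C / b * Real.exp (-(4 / 3) * b ^ 3 + 2 * t * b) := by
  obtain ⟨C, a₀, hC, ha₀, hshift⟩ :=
    airy_shift_asymptotics hu huAiry hv hvAiry hu0 hu'0 hv0 hv'0 ht hz hne
  have hα := airyAlpha_pos
  have hκ : 0 ≤ Real.sqrt 3 * airyAlpha * (u' (-t)) ^ 2 / t := by positivity
  set κ := Real.sqrt 3 * airyAlpha * (u' (-t)) ^ 2 / t
  set b₁ := 2 * a₀ + 2 * t with hb₁
  have hb₁pos : 0 < b₁ := by positivity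
  set C₁ := 2 * C + κ * (8 * (κ + C) + 4 / 3 * t ^ 2) with hC₁
  set C₂ := (t + κ * Real.exp (2 * t * b₁)) * b₁ * Real.exp (4 / 3 * b₁ ^ 3) with hC₂
  have hC₁pos : 0 < C₁ := by positivity
  have hC₂pos : 0 < C₂ := by positivity
  refine ⟨C₁ + C₂, by positivity, fun b hb y hy heq => ?_⟩
  have hδ0 : 0 ≤ y + t := by linarith [hy.1]
  have hδ : y + t ≤ t := by linarith [hy.2]
  set E := Real.exp (-(4 / 3) * b ^ 3 + 2 * t * b) with hE
  have hEpos : 0 < E := Real.exp_pos _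
  by_cases hbb : b₁ ≤ b
  · have hX : (b / 2) ^ 2 ≤ b ^ 2 + y := by nlinarith [hy.1]
    obtain ⟨a, ha, haX⟩ : ∃ a, b / 2 ≤ a ∧ a ^ 2 = b ^ 2 + y :=
      ⟨Real.sqrt (b ^ 2 + y), Real.le_sqrt_of_sq_le hX,
        Real.sq_sqrt ((sq_nonneg _).trans hX)⟩
    have haa : a₀ ≤ a := by linarith
    have ha1 : 1 ≤ a := ha₀.trans haa
    have ha0 : 0 < a := by linarith
    have h1 := hshift a haa y hy (by rw [haX]; exact heq)
    obtain ⟨h2, h3⟩ := abs_exp_cube_shift_le (t := t) (δ := y + t) ha0 hb hδ0 hδ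
      (by rw [haX]; ring)
    rw [← hE] at h2 h3
    set e := Real.exp (-(4 / 3) * a ^ 3) with he
    have hepos : 0 < e := Real.exp_pos _
    have hea : e ≤ 1 / a ^ 2 := by
      have k1 := Real.add_one_le_exp ((4 / 3) * a ^ 3)
      have k2 : a ^ 2 ≤ a ^ 3 := pow_le_pow_right₀ ha1 (by norm_num)
      rw [he, neg_mul, Real.exp_neg, ← one_div]
      gcongr
      nlinarith [sq_nonneg a]
    have hinva : 1 / a ≤ 2 / b := by
      rw [div_le_div_iff₀ ha0 hb]
      linarith
    have hδe : y + t ≤ (κ + C) * (2 / b) ^ 2 := by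
      have k1 := (abs_le.1 h1).2
      have k2 : C / a * e ≤ C * e := by
        gcongr
        exact div_le_self hC.le ha1
      calc y + t ≤ (κ + C) * e := by linarith
        _ ≤ (κ + C) * (1 / a) ^ 2 := by
          rw [one_div_pow]
          gcongr
        _ ≤ _ := by gcongr
    have h4 : 2 * b * (y + t) + 4 / 3 * t ^ 2 / b ≤ (8 * (κ + C) + 4 / 3 * t ^ 2) / b := by
      have : 2 * b * (y + t) ≤ 8 * (κ + C) / b := by
        calc _ ≤ 2 * b * ((κ + C) * (2 / b) ^ 2) := by gcongr
          _ = _ := by field_simp; ring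
      rw [add_div]
      linarith
    calc |y + t - κ * E| = |(y + t - κ * e) + κ * (e - E)| := by ring_nf
      _ ≤ |y + t - κ * e| + κ * |e - E| := by
        refine (abs_add_le _ _).trans (le_of_eq ?_)
        rw [abs_mul, abs_of_nonneg hκ]
      _ ≤ C * (2 / b) * E + κ * ((8 * (κ + C) + 4 / 3 * t ^ 2) / b * E) := by
        gcongr
        · refine h1.trans ?_
          rw [div_eq_mul_one_div C a]
          gcongr
        · exact h3.trans (by gcongr)
      _ = C₁ / b * E := by rw [hC₁]; ring
      _ ≤ _ := by
        gcongr
        linarith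
  · have hbb' : b ≤ b₁ := le_of_not_ge hbb
    have h1 : |y + t - κ * E| ≤ t + κ * Real.exp (2 * t * b₁) := by
      refine (abs_sub _ _).trans ?_
      rw [abs_of_nonneg hδ0, abs_of_nonneg (by positivity)]
      gcongr
      rw [hE]
      gcongr
      have : 0 ≤ b ^ 3 := by positivity
      nlinarith
    have h2 : Real.exp (-(4 / 3 * b₁ ^ 3)) ≤ E := by
      rw [hE]
      gcongr
      have : b ^ 3 ≤ b₁ ^ 3 := by gcongr
      have : 0 ≤ 2 * t * b := by positivity
      linarith
    calc |y + t - κ * E| ≤ t + κ * Real.exp (2 * t * b₁) := h1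
      _ = C₂ / b₁ * Real.exp (-(4 / 3 * b₁ ^ 3)) := by
        rw [hC₂, Real.exp_neg]
        field_simp
      _ ≤ (C₁ + C₂) / b * E := by
        gcongr
        linarith

theorem stmt_7 (u v u' v' : ℝ → ℝ)
    (hu : ∀ x, HasDerivAt u (u' x) x)
    (huAiry : ∀ x, HasDerivAt u' (x * u x) x)
    (hv : ∀ x, HasDerivAt v (v' x) x)
    (hvAiry : ∀ x, HasDerivAt v' (x * v x) x)
    (hu0 : u 0 = 1) (hu'0 : u' 0 = 0) (hv0 : v 0 = 0) (hv'0 : v' 0 = 1)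
    (ta1 : ℝ) (hta1pos : 0 < ta1)
    (hta1z : AiD u' v' (-ta1) = 0)
    (hta1ne : ∀ x : ℝ, -ta1 < x → AiD u' v' x ≠ 0) :
    ∀ τ : ℝ, 0 < τ → ∃ C : ℝ, 0 < C ∧
      ∀ h : ℝ, h ∈ Ioc (0:ℝ) ((ta1 + τ) ^ (-(3:ℝ)/2)) →
        ∀ E : ℝ,
          -(h ^ (-(2:ℝ)/3)) < E → E < 0 → -ta1 < -(h ^ (-(2:ℝ)/3)) - E →
          u' (-(h ^ (-(2:ℝ)/3)) - E) * v' (-E)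
            = v' (-(h ^ (-(2:ℝ)/3)) - E) * u' (-E) →
          |E + h ^ (-(2:ℝ)/3) - ta1
              + Real.sqrt 3 * airyAlpha * (u' (-ta1)) ^ 2 / ta1
                * Real.exp (-4/(3*h) + 2 * ta1 * h ^ (-(1:ℝ)/3))|
            ≤ C * h ^ ((1:ℝ)/3) * Real.exp (-4/(3*h) + 2 * ta1 * h ^ (-(1:ℝ)/3)) := by
  intro τ _
  obtain ⟨C, hC, hmain⟩ := airy_ground_state_asymptotics hu huAiry hv hvAiry hu0 hu'0 hv0 hv'0
    hta1pos hta1z hta1ne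
  refine ⟨C, hC, fun h hh E hE1 hE2 hE3 heq => ?_⟩
  have h0 : 0 < h := hh.1
  obtain ⟨b, hb⟩ : ∃ b, b = h ^ (-(1:ℝ)/3) := ⟨_, rfl⟩
  have hbpos : 0 < b := hb ▸ Real.rpow_pos_of_pos h0 _
  have hb2 : h ^ (-(2:ℝ)/3) = b ^ 2 := by
    rw [hb, ← Real.rpow_natCast, ← Real.rpow_mul h0.le]
    norm_num
  have hb3 : h = 1 / b ^ 3 := by
    rw [hb, ← Real.rpow_natCast, ← Real.rpow_mul h0.le]
    norm_num [Real.rpow_neg_one]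
  have hb1 : h ^ ((1:ℝ)/3) = 1 / b := by
    rw [hb, one_div (h ^ (-(1:ℝ)/3)), ← Real.rpow_neg h0.le]
    norm_num
  have hexp : -4/(3*h) + 2 * ta1 * b = -(4 / 3) * b ^ 3 + 2 * ta1 * b := by
    rw [hb3]
    field_simp
  rw [hb2] at hE1 hE3 heq ⊢
  rw [hb1, ← hb, hexp]
  have key := hmain b hbpos (-(b ^ 2) - E) ⟨hE3.le, by linarith⟩
    (by rw [show b ^ 2 + (-(b ^ 2) - E) = -E by ring]; exact heq)
  rw [← abs_neg]
  calc _ = _ := by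
        congr 1
        ring
    _ ≤ _ := key
    _ = _ := by ring
end

section
/- There exist C > 0 and h₀ > 0 such that for every h ≥ h₀ and every real E with −h^(−2/3) < E < 0, −h^(−2/3) − E > −ã₁, and u'(−h^(−2/3)−E)·v'(−E) = v'(−h^(−2/3)−E)·u'(−E) (i.e. E is the rescaled ground state E⁰_min at semiclassical parameter h), one has |h^(2/3)·E + 1/2 + 1/(120·h²)| ≤ C/h⁴; equivalently, as h → ∞, h^(2/3)·E⁰_min = −1/2 − 1/(120 h²) + O(h^(−4)). -/
open Real Set

/-- A function vanishing at `0` whose derivative is `O(|x| ^ n)` on `[-1, 1]` is itself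
`O(|x| ^ (n + 1))` there, with the same constant. -/
theorem abs_le_mul_pow_succ_of_abs_deriv_le {f g : ℝ → ℝ} {K : ℝ} {n : ℕ}
    (hf : ∀ x, HasDerivAt f (g x) x) (hf0 : f 0 = 0)
    (hg : ∀ x, |x| ≤ 1 → |g x| ≤ K * |x| ^ n) (x : ℝ) (hx : |x| ≤ 1) :
    |f x| ≤ K * |x| ^ (n + 1) := by
  have hK : 0 ≤ K := by simpa using (abs_nonneg _).trans (hg 1 (by simp))
  have key := (convex_Icc (-|x|) |x|).norm_image_sub_le_of_norm_hasDerivWithin_le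
    (f := f) (f' := g) (C := K * |x| ^ n) (x := 0) (y := x)
    (fun y _ ↦ (hf y).hasDerivWithinAt)
    (fun y hy ↦ by
      have hyx : |y| ≤ |x| := abs_le.2 hy
      rw [Real.norm_eq_abs]
      exact (hg y (hyx.trans hx)).trans (by gcongr))
    (by simp) ⟨neg_abs_le x, le_abs_self x⟩
  simpa [hf0, pow_succ, mul_assoc] using key

/-- If `f'` is the derivative of a solution of the Airy equation and `p' = x * q`, then a bound on
`f - q` integrates to a bound on `f' - p`. -/
theorem abs_airy_deriv_sub_le {f f' p q : ℝ → ℝ} {K : ℝ} {n : ℕ}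
    (hf' : ∀ x, HasDerivAt f' (x * f x) x) (hp : ∀ x, HasDerivAt p (x * q x) x)
    (h0 : f' 0 = p 0) (hfq : ∀ x, |x| ≤ 1 → |f x - q x| ≤ K * |x| ^ n)
    (x : ℝ) (hx : |x| ≤ 1) : |f' x - p x| ≤ K * |x| ^ (n + 2) := by
  refine abs_le_mul_pow_succ_of_abs_deriv_le (f := fun y ↦ f' y - p y)
    (fun y ↦ (hf' y).sub (hp y)) (by simp [h0]) (fun y hy ↦ ?_) x hx
  rw [← mul_sub, abs_mul, pow_succ]
  nlinarith [hfq y hy, abs_nonneg y]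

theorem abs_sub_le_of_abs_deriv_sub_le {f f' p p' : ℝ → ℝ} {K : ℝ} {n : ℕ}
    (hf : ∀ x, HasDerivAt f (f' x) x) (hp : ∀ x, HasDerivAt p (p' x) x)
    (h0 : f 0 = p 0) (hfp : ∀ x, |x| ≤ 1 → |f' x - p' x| ≤ K * |x| ^ n)
    (x : ℝ) (hx : |x| ≤ 1) : |f x - p x| ≤ K * |x| ^ (n + 1) :=
  abs_le_mul_pow_succ_of_abs_deriv_le (f := fun y ↦ f y - p y)
    (fun y ↦ (hf y).sub (hp y)) (by simp [h0]) hfp x hx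

theorem exists_abs_le_of_hasDerivAt {f f' : ℝ → ℝ} (hf : ∀ x, HasDerivAt f (f' x) x) :
    ∃ M, ∀ x, |x| ≤ 1 → |f x| ≤ M := by
  have hc : Continuous f := continuous_iff_continuousAt.2 fun x ↦ (hf x).continuousAt
  obtain ⟨M, hM⟩ := (isCompact_Icc (a := (-1 : ℝ)) (b := 1)).exists_bound_of_continuousOn
    hc.continuousOn
  exact ⟨M, fun x hx ↦ hM x (abs_le.1 hx)⟩

theorem airy_u_deriv_expansion {u u' : ℝ → ℝ} {M : ℝ}
    (hu : ∀ x, HasDerivAt u (u' x) x) (hu' : ∀ x, HasDerivAt u' (x * u x) x)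
    (hu0 : u 0 = 1) (hu'0 : u' 0 = 0) (hM : ∀ x, |x| ≤ 1 → |u x| ≤ M) (x : ℝ) (hx : |x| ≤ 1) :
    |u' x - (x ^ 2 / 2 + x ^ 5 / 30)| ≤ M * |x| ^ 8 := by
  have h1 := abs_airy_deriv_sub_le (p := fun _ ↦ 0) (q := fun _ ↦ 0) (K := M) (n := 0) hu'
    (fun x ↦ by simpa using hasDerivAt_const x (0 : ℝ)) (by simp [hu'0]) (by simpa using hM)
  have h2 := abs_sub_le_of_abs_deriv_sub_le (p := fun _ ↦ 1) hu
    (fun x ↦ hasDerivAt_const x (1 : ℝ)) (by simp [hu0]) h1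
  have h3 := abs_airy_deriv_sub_le (p := fun x ↦ x ^ 2 / 2) hu'
    (fun x ↦ by
      refine ((hasDerivAt_pow 2 x).div_const 2).congr_deriv ?_
      norm_num) (by simp [hu'0]) h2
  have h4 := abs_sub_le_of_abs_deriv_sub_le (p := fun x ↦ 1 + x ^ 3 / 6) hu
    (fun x ↦ by
      refine (((hasDerivAt_pow 3 x).div_const 6).const_add 1).congr_deriv ?_
      norm_num
      ring) (by simp [hu0]) h3
  exact abs_airy_deriv_sub_le (p := fun x ↦ x ^ 2 / 2 + x ^ 5 / 30) hu'
    (fun x ↦ by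
      refine (((hasDerivAt_pow 2 x).div_const 2).add
        ((hasDerivAt_pow 5 x).div_const 30)).congr_deriv ?_
      norm_num
      ring) (by simp [hu'0]) h4 x hx

theorem airy_v_deriv_expansion {v v' : ℝ → ℝ} {M : ℝ}
    (hv : ∀ x, HasDerivAt v (v' x) x) (hv' : ∀ x, HasDerivAt v' (x * v x) x)
    (hv0 : v 0 = 0) (hv'0 : v' 0 = 1) (hM : ∀ x, |x| ≤ 1 → |v' x| ≤ M) (x : ℝ) (hx : |x| ≤ 1) :
    |v' x - (1 + x ^ 3 / 3)| ≤ M * |x| ^ 6 := by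
  have h1 := abs_sub_le_of_abs_deriv_sub_le (p := fun _ ↦ 0) (p' := fun _ ↦ 0) (K := M) (n := 0) hv
    (fun x ↦ hasDerivAt_const x (0 : ℝ)) (by simp [hv0]) (by simpa using hM)
  have h2 := abs_airy_deriv_sub_le (p := fun _ ↦ 1) hv'
    (fun x ↦ by simpa using hasDerivAt_const x (1 : ℝ)) (by simp [hv'0]) h1
  have h3 := abs_sub_le_of_abs_deriv_sub_le (p := fun x ↦ x) hv
    (fun x ↦ hasDerivAt_id' x) (by simp [hv0]) h2
  exact abs_airy_deriv_sub_le (p := fun x ↦ 1 + x ^ 3 / 3) hv'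
    (fun x ↦ by
      refine (((hasDerivAt_pow 3 x).div_const 3).const_add 1).congr_deriv ?_
      norm_num
      ring) (by simp [hv'0]) h3 x hx

theorem abs_mul_sub_mul_le {α β A B M c : ℝ}
    (hα : |α - A| ≤ M * c ^ 8) (hβ : |β - B| ≤ M * c ^ 6) (hβM : |β| ≤ M) (hA : |A| ≤ c ^ 2) :
    |α * β - A * B| ≤ (M ^ 2 + M) * c ^ 8 := by
  have hM : 0 ≤ M := (abs_nonneg _).trans hβM
  calc |α * β - A * B| = |(α - A) * β + A * (β - B)| := by ring_nf
    _ ≤ |α - A| * |β| + |A| * |β - B| := by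
        simpa only [abs_mul] using abs_add_le ((α - A) * β) (A * (β - B))
    _ ≤ M * c ^ 8 * M + c ^ 2 * (M * c ^ 6) := by gcongr
    _ = (M ^ 2 + M) * c ^ 8 := by ring

theorem abs_sq_add_pow_five_le {x c : ℝ} (hc1 : c ≤ 1) (hx : |x| ≤ c) :
    |x ^ 2 / 2 + x ^ 5 / 30| ≤ c ^ 2 := by
  have hc : 0 ≤ c := (abs_nonneg _).trans hx
  have h2 : |x| ^ 2 ≤ c ^ 2 := by gcongr
  have h5 : |x| ^ 5 ≤ c ^ 2 := (by gcongr : |x| ^ 5 ≤ c ^ 5).trans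
    (pow_le_pow_of_le_one hc hc1 (by norm_num))
  rw [← abs_pow] at h2 h5
  rw [abs_le] at *
  constructor <;> linarith

/-- The two-term expansion of the root of the Neumann condition for the Airy equation on the
interval `[-c (1 - s), c s]`. -/
theorem abs_neumann_root_sub_le {u' v' : ℝ → ℝ} {M c s : ℝ}
    (hM0 : 0 ≤ M) (hc0 : 0 < c) (hc1 : c ≤ 1) (hs0 : 0 < s) (hs1 : s < 1)
    (hue : ∀ x, |x| ≤ 1 → |u' x - (x ^ 2 / 2 + x ^ 5 / 30)| ≤ M * |x| ^ 8)
    (hve : ∀ x, |x| ≤ 1 → |v' x - (1 + x ^ 3 / 3)| ≤ M * |x| ^ 6)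
    (hvM : ∀ x, |x| ≤ 1 → |v' x| ≤ M)
    (heq : u' (-(c * (1 - s))) * v' (c * s) = v' (-(c * (1 - s))) * u' (c * s)) :
    |s - 1 / 2 - c ^ 3 / 120| ≤ (4 * (M ^ 2 + M) + 3) * c ^ 6 := by
  have hxa : |-(c * (1 - s))| ≤ c := by rw [abs_le]; constructor <;> nlinarith
  have hxb : |c * s| ≤ c := by rw [abs_le]; constructor <;> nlinarith
  have hue' : ∀ x, |x| ≤ c → |u' x - (x ^ 2 / 2 + x ^ 5 / 30)| ≤ M * c ^ 8 := fun x hx ↦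
    (hue x (hx.trans hc1)).trans (by gcongr)
  have hve' : ∀ x, |x| ≤ c → |v' x - (1 + x ^ 3 / 3)| ≤ M * c ^ 6 := fun x hx ↦
    (hve x (hx.trans hc1)).trans (by gcongr)
  have h1 := abs_mul_sub_mul_le (hue' _ hxa) (hve' _ hxb) (hvM _ (hxb.trans hc1))
    (abs_sq_add_pow_five_le hc1 hxa)
  have h2 := abs_mul_sub_mul_le (hue' _ hxb) (hve' _ hxa) (hvM _ (hxa.trans hc1))
    (abs_sq_add_pow_five_le hc1 hxb)
  obtain ⟨t, rfl⟩ : ∃ t, s = (1 + t) / 2 := ⟨2 * s - 1, by ring⟩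
  have ht : |t| ≤ 1 := abs_le.2 ⟨by linarith, by linarith⟩
  have hq : |t * (1 - t ^ 2) ^ 3| ≤ 1 := by
    have h3 : |1 - t ^ 2| ≤ 1 := by
      have := (sq_le_one_iff_abs_le_one t).2 ht
      rw [abs_le]; constructor <;> nlinarith [sq_nonneg t]
    rw [abs_mul, abs_pow]
    exact mul_le_one₀ ht (by positivity) (pow_le_one₀ (abs_nonneg _) h3)
  set L := M ^ 2 + M with hL
  have hL0 : 0 ≤ L := by positivity
  set a := -(c * (1 - (1 + t) / 2)) with ha
  set b := c * ((1 + t) / 2) with hb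
  have hid : (a ^ 2 / 2 + a ^ 5 / 30) * (1 + b ^ 3 / 3) - (b ^ 2 / 2 + b ^ 5 / 30) * (1 + a ^ 3 / 3)
      = c ^ 2 * (-(t / 2 - c ^ 3 / 120 + c ^ 3 * t ^ 2 / 24)
        + c ^ 6 * (t * (1 - t ^ 2) ^ 3 / 5760)) := by
    rw [ha, hb]; ring
  have h3 : |c ^ 2 * (-(t / 2 - c ^ 3 / 120 + c ^ 3 * t ^ 2 / 24)
        + c ^ 6 * (t * (1 - t ^ 2) ^ 3 / 5760))| ≤ c ^ 2 * (2 * L * c ^ 6) := by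
    rw [← hid]
    rw [abs_le] at h1 h2 ⊢
    constructor <;> linarith
  rw [abs_mul, abs_of_pos (by positivity : 0 < c ^ 2)] at h3
  have h4 := le_of_mul_le_mul_left h3 (by positivity)
  have h5 : |t / 2 - c ^ 3 / 120 + c ^ 3 * t ^ 2 / 24| ≤ (2 * L + 1) * c ^ 6 := by
    rw [abs_le] at h4 hq ⊢
    have := pow_pos hc0 6
    constructor <;> nlinarith
  have hc63 : c ^ 6 ≤ c ^ 3 := pow_le_pow_of_le_one hc0.le hc1 (by norm_num)
  have ht2 : t ^ 2 ≤ 1 := (sq_le_one_iff_abs_le_one t).2 ht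
  have h9 : 0 ≤ c ^ 3 * t ^ 2 := by positivity
  have h10 : 0 ≤ L * c ^ 6 := by positivity
  have h11 : 0 ≤ c ^ 6 := by positivity
  have h12 : L * c ^ 6 ≤ L * c ^ 3 := by gcongr
  have h13 : c ^ 3 * t ^ 2 ≤ c ^ 3 * 1 := by gcongr
  have h14 : 0 < c ^ 3 := by positivity
  have h6 : |t| ≤ (4 * L + 3) * c ^ 3 := by
    rw [abs_le] at h5 ⊢
    constructor <;> linarith
  have h7 : t ^ 2 ≤ (4 * L + 3) * c ^ 3 := by
    rw [← sq_abs]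
    nlinarith [abs_nonneg t]
  have h8 : c ^ 3 * t ^ 2 ≤ (4 * L + 3) * c ^ 6 := by
    calc c ^ 3 * t ^ 2 ≤ c ^ 3 * ((4 * L + 3) * c ^ 3) := by gcongr
      _ = (4 * L + 3) * c ^ 6 := by ring
  rw [abs_le] at h5 ⊢
  constructor <;> linarith

theorem stmt_8 (u v u' v' : ℝ → ℝ)
    (hu : ∀ x, HasDerivAt u (u' x) x)
    (huAiry : ∀ x, HasDerivAt u' (x * u x) x)
    (hv : ∀ x, HasDerivAt v (v' x) x)
    (hvAiry : ∀ x, HasDerivAt v' (x * v x) x)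
    (hu0 : u 0 = 1) (hu'0 : u' 0 = 0) (hv0 : v 0 = 0) (hv'0 : v' 0 = 1)
    (ta1 : ℝ) (hta1pos : 0 < ta1)
    (hta1z : AiD u' v' (-ta1) = 0)
    (hta1ne : ∀ x : ℝ, -ta1 < x → AiD u' v' x ≠ 0) :
    ∃ C : ℝ, 0 < C ∧ ∃ h₀ : ℝ, 0 < h₀ ∧
      ∀ h : ℝ, h₀ ≤ h →
        ∀ E : ℝ,
          -(h ^ (-(2:ℝ)/3)) < E → E < 0 → -ta1 < -(h ^ (-(2:ℝ)/3)) - E →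
          u' (-(h ^ (-(2:ℝ)/3)) - E) * v' (-E)
            = v' (-(h ^ (-(2:ℝ)/3)) - E) * u' (-E) →
          |h ^ ((2:ℝ)/3) * E + 1/2 + 1/(120 * h ^ 2)| ≤ C / h ^ 4 := by
  obtain ⟨M₁, hM₁⟩ := exists_abs_le_of_hasDerivAt hu
  obtain ⟨M₂, hM₂⟩ := exists_abs_le_of_hasDerivAt hvAiry
  set M := max M₁ M₂
  have hM₁' : ∀ x, |x| ≤ 1 → |u x| ≤ M := fun x hx ↦ (hM₁ x hx).trans (le_max_left _ _)
  have hM₂' : ∀ x, |x| ≤ 1 → |v' x| ≤ M := fun x hx ↦ (hM₂ x hx).trans (le_max_right _ _)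
  have hM0 : 0 ≤ M := (abs_nonneg _).trans (hM₁' 0 (by simp))
  refine ⟨4 * (M ^ 2 + M) + 3, by positivity, 1, one_pos, fun h hh E hE1 hE2 _ heq ↦ ?_⟩
  have hpos : 0 < h := by linarith
  set c := h ^ (-(2:ℝ)/3) with hc
  have hc0 : 0 < c := Real.rpow_pos_of_pos hpos _
  have hc1 : c ≤ 1 := Real.rpow_le_one_of_one_le_of_nonpos hh (by norm_num)
  have hc3 : c ^ 3 = 1 / h ^ 2 := by
    rw [hc, ← Real.rpow_mul_natCast hpos.le, one_div, ← Real.rpow_natCast h 2,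
      ← Real.rpow_neg hpos.le]
    norm_num
  have hcinv : h ^ ((2:ℝ)/3) = c⁻¹ := by
    rw [hc, ← Real.rpow_neg hpos.le]
    norm_num
  obtain ⟨s, rfl⟩ : ∃ s, E = -(c * s) := ⟨-E / c, by field_simp⟩
  have hs0 : 0 < s := by
    by_contra! hs
    nlinarith
  have hs1 : s < 1 := by nlinarith
  have key := abs_neumann_root_sub_le (u' := u') (v' := v') hM0 hc0 hc1 hs0 hs1
    (airy_u_deriv_expansion hu huAiry hu0 hu'0 hM₁')
    (airy_v_deriv_expansion hv hvAiry hv0 hv'0 hM₂') hM₂'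
    (by
      have ha : -(c * (1 - s)) = -c - -(c * s) := by ring
      rw [ha]
      simpa using heq)
  have hc6 : c ^ 6 = 1 / h ^ 4 := by
    rw [show c ^ 6 = (c ^ 3) ^ 2 by ring, hc3, div_pow, ← pow_mul, one_pow]
  have he : h ^ ((2:ℝ)/3) * -(c * s) + 1/2 + 1/(120 * h ^ 2) = -(s - 1 / 2 - c ^ 3 / 120) := by
    rw [hcinv, hc3]
    field_simp
    ring
  rw [he, abs_neg, div_eq_mul_one_div _ (h ^ 4), ← hc6]
  exact key
end

section
/- (i) For every c in (0, c₀] and every real E < 0, one has v(−E)·u'(−c−E) ≠ u(−E)·v'(−c−E) and v'(−E)·u(−c−E) ≠ u'(−E)·v(−c−E) (so no rescaled spectral gap edge of the periodic Airy–Schrödinger operator lies in [−c, 0)). (ii) For every c > c₀ there exists E with −c < E < 0 such that v(−E)·u'(−c−E) = u(−E)·v'(−c−E) (so the first rescaled spectral gap intersects [−c, 0] as soon as c > c₀). -/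
open Real Set

lemma lt_of_forall_hasDerivAt_pos {f f' : ℝ → ℝ} {a b : ℝ} (hab : a < b)
    (hf : ∀ x, HasDerivAt f (f' x) x) (h : ∀ x ∈ Ioo a b, 0 < f' x) : f a < f b := by
  obtain ⟨x, hx, he⟩ := exists_hasDerivAt_eq_slope f f' hab
    (fun x _ => (hf x).continuousAt.continuousWithinAt) (fun x _ => hf x)
  have := h x hx
  rw [he, div_pos_iff_of_pos_right (by linarith)] at this
  linarith

lemma le_of_forall_hasDerivAt_nonneg {f f' : ℝ → ℝ} {a b : ℝ} (hab : a ≤ b)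
    (hf : ∀ x, HasDerivAt f (f' x) x) (h : ∀ x ∈ Ioo a b, 0 ≤ f' x) : f a ≤ f b := by
  rcases hab.eq_or_lt with rfl | hab
  · exact le_rfl
  obtain ⟨x, hx, he⟩ := exists_hasDerivAt_eq_slope f f' hab
    (fun x _ => (hf x).continuousAt.continuousWithinAt) (fun x _ => hf x)
  have := h x hx
  rw [he] at this
  by_contra! hlt
  exact absurd this (not_le.2 (div_neg_of_neg_of_pos (by linarith) (by linarith)))

lemma continuous_of_forall_hasDerivAt {f f' : ℝ → ℝ} (hf : ∀ x, HasDerivAt f (f' x) x) :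
    Continuous f :=
  continuous_iff_continuousAt.2 fun x => (hf x).continuousAt

/-- A continuous function that is positive at `b` and vanishes at `a < b` has a last zero
before `b`, after which it is positive. -/
lemma exists_last_zero {f : ℝ → ℝ} (hf : Continuous f) {a b : ℝ} (hab : a ≤ b)
    (ha : f a = 0) (hb : 0 < f b) :
    ∃ z, a ≤ z ∧ z < b ∧ f z = 0 ∧ ∀ x ∈ Ioc z b, 0 < f x := by
  have hK : IsCompact (Icc a b ∩ f ⁻¹' {0}) :=
    isCompact_Icc.inter_right (isClosed_singleton.preimage hf)
  obtain ⟨z, ⟨⟨haz, hzb⟩, hz⟩, hmax⟩ := hK.exists_isGreatest ⟨a, ⟨le_rfl, hab⟩, ha⟩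
  have hz0 : f z = 0 := hz
  refine ⟨z, haz, lt_of_le_of_ne hzb ?_, hz0, ?_⟩
  · rintro rfl
    exact hb.ne' hz0
  · intro x hx
    by_contra! hle
    obtain ⟨y, hy, hy0⟩ := intermediate_value_Icc hx.2 hf.continuousOn ⟨hle, hb.le⟩
    have := hmax ⟨⟨haz.trans (hx.1.le.trans hy.1), hy.2⟩, hy0⟩
    linarith [hx.1, hy.1]

/-- Sturm comparison with mixed boundary conditions: raising the potential of `v'' = x v` delays
the first critical point to the left of the common zero `0`. -/
lemma deriv_ne_zero_of_larger_potential {v v' y y' : ℝ → ℝ} {a c : ℝ} (ha : 0 < a)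
    (hc : 0 < c)
    (hv : ∀ x, HasDerivAt v (v' x) x) (hv' : ∀ x, HasDerivAt v' (x * v x) x)
    (hy : ∀ x, HasDerivAt y (y' x) x) (hy' : ∀ x, HasDerivAt y' ((a + x) * y x) x)
    (hv0 : v 0 = 0) (hy0 : y 0 = 0) (hy'0 : 0 < y' 0)
    (hpos : ∀ x, -c < x → 0 < v' x) (hnn : 0 ≤ v' (-c)) : y' (-c) ≠ 0 := by
  intro h0
  obtain ⟨z, hcz, hz0, hz, hzpos⟩ := exists_last_zero (continuous_of_forall_hasDerivAt hy')
    (by linarith : -c ≤ 0) h0 hy'0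
  have hyneg : ∀ x, z ≤ x → x < 0 → y x < 0 := fun x hx hx0 => by
    rw [← hy0]
    exact lt_of_forall_hasDerivAt_pos hx0 hy fun t ht => hzpos t ⟨hx.trans_lt ht.1, ht.2.le⟩
  have hvneg : ∀ x, z ≤ x → x < 0 → v x < 0 := fun x hx hx0 => by
    rw [← hv0]
    exact lt_of_forall_hasDerivAt_pos hx0 hv fun t ht => hpos t (by linarith [ht.1])
  have hW : ∀ x, HasDerivAt (fun x => y' x * v x - y x * v' x) (a * (y x * v x)) x :=
    fun x => (((hy' x).mul (hv x)).sub ((hy x).mul (hv' x))).congr_deriv (by ring)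
  have hlt := lt_of_forall_hasDerivAt_pos hz0 hW fun t ht =>
    mul_pos ha (mul_pos_of_neg_of_neg (hyneg t ht.1.le ht.2) (hvneg t ht.1.le ht.2))
  have hvz : 0 ≤ v' z := by
    rcases hcz.eq_or_lt with rfl | h
    · exact hnn
    · exact (hpos z h).le
  simp only [hz, hv0, hy0] at hlt
  nlinarith [hyneg z le_rfl hz0]

/-- A solution of `y'' = (a + x) y`, `a > 0`, with positive value and zero slope at `0` has no
zero on `[-9/5, 0]`; the comparison function is `1 + x ^ 3 / 6`. -/
lemma ne_zero_of_neumann_at_zero {y y' : ℝ → ℝ} {a c : ℝ} (ha : 0 < a)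
    (hc : 0 < c) (hc' : c ≤ 9 / 5)
    (hy : ∀ x, HasDerivAt y (y' x) x) (hy' : ∀ x, HasDerivAt y' ((a + x) * y x) x)
    (hy0 : 0 < y 0) (hy'0 : y' 0 = 0) : y (-c) ≠ 0 := by
  intro h0
  obtain ⟨z, hcz, hz0, hz, hzpos⟩ := exists_last_zero (continuous_of_forall_hasDerivAt hy)
    (by linarith : -c ≤ 0) h0 hy0
  have hP : ∀ x, z ≤ x → 0 < 1 + x ^ 3 / 6 := fun x hx => by
    have : (-(9 / 5) : ℝ) ^ 3 ≤ x ^ 3 :=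
      (Odd.pow_le_pow (by decide : Odd 3)).2 (by linarith)
    norm_num at this
    linarith
  have hpow : ∀ x : ℝ, HasDerivAt (fun x : ℝ => 1 + x ^ 3 / 6) (x ^ 2 / 2) x := fun x =>
    (((hasDerivAt_pow 3 x).div_const 6).const_add 1).congr_deriv (by norm_num; ring)
  have hpow' : ∀ x : ℝ, HasDerivAt (fun x : ℝ => x ^ 2 / 2) x x := fun x =>
    ((hasDerivAt_pow 2 x).div_const 2).congr_deriv (by norm_num)
  have hW : ∀ x, HasDerivAt (fun x => y' x * (1 + x ^ 3 / 6) - y x * (x ^ 2 / 2))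
      (y x * (a * (1 + x ^ 3 / 6) + x ^ 4 / 6)) x :=
    fun x => (((hy' x).mul (hpow x)).sub ((hy x).mul (hpow' x))).congr_deriv (by ring)
  have hlt := lt_of_forall_hasDerivAt_pos hz0 hW fun t ht =>
    mul_pos (hzpos t ⟨ht.1, ht.2.le⟩)
      (add_pos_of_pos_of_nonneg (mul_pos ha (hP t ht.1.le)) (by positivity))
  simp only [hz, hy'0] at hlt
  have hneg : y' z < 0 := by nlinarith [hP z le_rfl]
  -- a negative slope at `z` is incompatible with `y > 0` just to the right of `z`
  have hev : ∀ᶠ x in nhds z, y' x < 0 :=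
    (hy' z).continuousAt.eventually (gt_mem_nhds hneg)
  obtain ⟨e, he, hball⟩ := Metric.eventually_nhds_iff.1 hev
  obtain ⟨w, hzw, hw⟩ := exists_between (lt_min hz0 (by linarith : z < z + e))
  have hwe : w < z + e := hw.trans_le (min_le_right _ _)
  have hdec := lt_of_forall_hasDerivAt_pos hzw (fun x => (hy x).neg) fun t ht => by
    have : y' t < 0 := hball (by rw [Real.dist_eq, abs_lt]; constructor <;> linarith [ht.1, ht.2])
    linarith
  have := hzpos w ⟨hzw, (hw.trans_le (min_le_left _ _)).le⟩
  simp only [Pi.neg_apply, hz] at hdec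
  linarith

/-- The largest zero `-c` of `v'`, where `v'' = x v`, `v 0 = 0`, `v' 0 = 1`, satisfies
`c < 9/5`. -/
lemma airy_critical_point_bound {v v' : ℝ → ℝ} {c : ℝ}
    (hv : ∀ x, HasDerivAt v (v' x) x) (hv' : ∀ x, HasDerivAt v' (x * v x) x)
    (hv0 : v 0 = 0) (hv'0 : v' 0 = 1)
    (hpos : ∀ x, -c < x → 0 < v' x) (hz : v' (-c) = 0) : c < 9 / 5 := by
  by_contra! hc
  have hpow (n : ℕ) (k : ℝ) (x : ℝ) :
      HasDerivAt (fun x : ℝ => x ^ (n + 1) / k) ((n + 1) * x ^ n / k) x :=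
    ((hasDerivAt_pow (n + 1) x).div_const k).congr_deriv (by push_cast; simp)
  have v_nonpos : ∀ x, -(9 / 5) ≤ x → x ≤ 0 → v x ≤ 0 := fun x hx hx0 => by
    rw [← hv0]
    exact le_of_forall_hasDerivAt_nonneg hx0 hv fun t ht => (hpos t (by linarith [ht.1])).le
  have v'_le : ∀ x, -(9 / 5) ≤ x → x ≤ 0 → v' x ≤ 1 := fun x hx hx0 => by
    rw [← hv'0]
    exact le_of_forall_hasDerivAt_nonneg hx0 hv' fun t ht =>
      mul_nonneg_of_nonpos_of_nonpos ht.2.le (v_nonpos t (by linarith [ht.1]) ht.2.le)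
  have le_v : ∀ x, -(9 / 5) ≤ x → x ≤ 0 → x ≤ v x := fun x hx hx0 => by
    have := le_of_forall_hasDerivAt_nonneg hx0 (fun t => (hasDerivAt_id t).sub (hv t))
      fun t ht => by linarith [v'_le t (by linarith [ht.1]) ht.2.le]
    simp only [Pi.sub_apply, id, hv0] at this
    linarith
  have le_v' : ∀ x, -(9 / 5) ≤ x → x ≤ 0 → 1 + x ^ 3 / 3 ≤ v' x := fun x hx hx0 => by
    have := le_of_forall_hasDerivAt_nonneg hx0 (fun t => (hpow 2 3 t).sub (hv' t))
      fun t ht => by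
        have := le_v t (by linarith [ht.1]) ht.2.le
        norm_num
        nlinarith [ht.2]
    simp only [Pi.sub_apply, hv'0] at this
    norm_num at this
    linarith
  have v_le : ∀ x, -(9 / 5) ≤ x → x ≤ 0 → v x ≤ x + x ^ 4 / 12 := fun x hx hx0 => by
    have := le_of_forall_hasDerivAt_nonneg hx0
      (fun t => ((hv t).sub (hasDerivAt_id t)).sub (hpow 3 12 t))
      fun t ht => by
        have := le_v' t (by linarith [ht.1]) ht.2.le
        norm_num
        linarith
    simp only [Pi.sub_apply, id, hv0] at this
    norm_num at this
    linarith
  have := le_of_forall_hasDerivAt_nonneg (by norm_num : (-(9 / 5) : ℝ) ≤ 0)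
    (fun t => ((hv' t).sub (hpow 2 3 t)).sub (hpow 5 72 t))
    fun t ht => by
      have := v_le t (by linarith [ht.1]) ht.2.le
      norm_num
      nlinarith [ht.2]
  simp only [Pi.sub_apply, hv'0] at this
  norm_num at this
  rcases hc.eq_or_lt with h | h
  · rw [← h] at hz
    norm_num at hz
    linarith
  · linarith [hpos (-(9 / 5)) (by linarith)]

/-- A solution of `u'' = x u` with `u 0 = 1`, `u' 0 = 0` is positive on `[0, ∞)`. -/
lemma airy_pos_of_nonneg {u u' : ℝ → ℝ}
    (hu : ∀ x, HasDerivAt u (u' x) x) (hu' : ∀ x, HasDerivAt u' (x * u x) x)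
    (hu0 : u 0 = 1) (hu'0 : u' 0 = 0) {c : ℝ} (hc : 0 ≤ c) : 0 < u c := by
  have huu' : ∀ x, 0 ≤ x → 0 ≤ u x * u' x := fun x hx => by
    have := le_of_forall_hasDerivAt_nonneg hx (fun t => (hu t).mul (hu' t)) fun t ht => by
      have := mul_nonneg ht.1.le (mul_self_nonneg (u t))
      nlinarith [mul_self_nonneg (u' t)]
    simpa [hu'0] using this
  have hsq : ∀ x, 0 ≤ x → u x ≠ 0 := fun x hx h => by
    have := le_of_forall_hasDerivAt_nonneg hx (fun t => (hu t).mul (hu t)) fun t ht => by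
      have := huu' t ht.1.le
      linarith
    simp only [Pi.mul_apply, hu0, h] at this
    linarith
  by_contra! hle
  obtain ⟨y, hy, hy0⟩ := intermediate_value_Icc' hc
    (continuous_of_forall_hasDerivAt hu).continuousOn ⟨hle, by rw [hu0]; exact zero_le_one⟩
  exact hsq y hy.1 hy0

theorem stmt_10 (u v u' v' : ℝ → ℝ)
    (hu : ∀ x, HasDerivAt u (u' x) x)
    (huAiry : ∀ x, HasDerivAt u' (x * u x) x)
    (hv : ∀ x, HasDerivAt v (v' x) x)
    (hvAiry : ∀ x, HasDerivAt v' (x * v x) x)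
    (hu0 : u 0 = 1) (hu'0 : u' 0 = 0) (hv0 : v 0 = 0) (hv'0 : v' 0 = 1)
    (c0 : ℝ) (hc0pos : 0 < c0)
    (hc0z : v' (-c0) = 0)
    (hc0ne : ∀ x : ℝ, -c0 < x → v' x ≠ 0) :
    -- (i) no gap edge in [-c, 0) for c ≤ c₀
    (∀ c : ℝ, c ∈ Ioc (0:ℝ) c0 → ∀ E : ℝ, E < 0 →
      v (-E) * u' (-c - E) ≠ u (-E) * v' (-c - E) ∧
      v' (-E) * u (-c - E) ≠ u' (-E) * v (-c - E)) ∧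
    -- (ii) a gap edge appears in (-c, 0) as soon as c > c₀
    (∀ c : ℝ, c0 < c → ∃ E : ℝ, -c < E ∧ E < 0 ∧
      v (-E) * u' (-c - E) = u (-E) * v' (-c - E)) := by
  have cu := continuous_of_forall_hasDerivAt hu
  have cu' := continuous_of_forall_hasDerivAt huAiry
  have cv := continuous_of_forall_hasDerivAt hv
  have cv' := continuous_of_forall_hasDerivAt hvAiry
  have hwronskian : ∀ x, u x * v' x - u' x * v x = 1 := fun x => by
    have hW : ∀ x, HasDerivAt (fun x => u x * v' x - u' x * v x) 0 x := fun x =>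
      (((hu x).mul (hvAiry x)).sub ((huAiry x).mul (hv x))).congr_deriv (by ring)
    have := is_const_of_deriv_eq_zero (fun x => (hW x).differentiableAt)
      (fun x => (hW x).deriv) x 0
    simpa [hu0, hu'0, hv0, hv'0] using this
  have hpos : ∀ x, -c0 < x → 0 < v' x := fun x hx => by
    by_contra! hle
    have h01 : (0 : ℝ) ∈ Icc (v' x) (v' 0) := ⟨hle, by rw [hv'0]; exact zero_le_one⟩
    obtain ⟨y, hy, hy0⟩ := intermediate_value_uIcc cv'.continuousOn (Icc_subset_uIcc h01)
    have hmin : -c0 < min x 0 := lt_min hx (by linarith)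
    exact hc0ne y (hmin.trans_le hy.1) hy0
  refine ⟨fun c hc E hE => ?_, fun c hc => ?_⟩
  · obtain ⟨hc1, hc2⟩ := hc
    have hc0lt := airy_critical_point_bound hv hvAiry hv0 hv'0 hpos hc0z
    obtain ⟨a, rfl⟩ : ∃ a, E = -a := ⟨-E, by ring⟩
    have hW := hwronskian a
    have comb (p q x : ℝ) : HasDerivAt (fun t => p * u (a + t) - q * v (a + t))
        (p * u' (a + x) - q * v' (a + x)) x :=
      (((hu (a + x)).comp_const_add a x).const_mul p).sub
        (((hv (a + x)).comp_const_add a x).const_mul q)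
    have comb' (p q x : ℝ) : HasDerivAt (fun t => p * u' (a + t) - q * v' (a + t))
        ((a + x) * (p * u (a + x) - q * v (a + x))) x :=
      ((((huAiry (a + x)).comp_const_add a x).const_mul p).sub
        (((hvAiry (a + x)).comp_const_add a x).const_mul q)).congr_deriv (by ring)
    have ha : 0 < a := by linarith
    rw [neg_neg, show -c - -a = a + -c by ring]
    constructor
    · intro h
      refine deriv_ne_zero_of_larger_potential ha hc1 hv hvAiry (comb (-v a) (-u a))
        (comb' (-v a) (-u a)) hv0 (by simp only [add_zero]; ring)
        (by simp only [add_zero]; linarith) (fun x hx => hpos x (by linarith)) ?_ (by linarith)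
      rcases hc2.eq_or_lt with rfl | h
      · exact hc0z.ge
      · exact (hpos _ (by linarith)).le
    · intro h
      exact ne_zero_of_neumann_at_zero ha hc1 (by linarith) (comb (v' a) (u' a))
        (comb' (v' a) (u' a)) (by simp only [add_zero]; linarith)
        (by simp only [add_zero]; ring) (by linarith)
  · have hvneg : v (-c0) < 0 := by
      rw [← hv0]
      exact lt_of_forall_hasDerivAt_pos (by linarith) hv fun t ht => hpos t ht.1
    have hvpos : 0 < v (c - c0) := by
      rw [← hv0]
      exact lt_of_forall_hasDerivAt_pos (by linarith) hv fun t ht => hpos t (by linarith [ht.1])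
    have hu'pos : 0 < u' (-c0) := by
      have := hwronskian (-c0)
      rw [hc0z] at this
      by_contra! hle
      nlinarith
    have hupos : 0 < u c := airy_pos_of_nonneg hu huAiry hu0 hu'0 (by linarith)
    have hcont : Continuous fun a => v a * u' (a - c) - u a * v' (a - c) := by fun_prop
    obtain ⟨a, ha, ha0⟩ := intermediate_value_Ioo' (by linarith : c - c0 ≤ c) hcont.continuousOn
      (show (0 : ℝ) ∈ Ioo _ _ by
        constructor
        · simp [hu'0, hv'0, hupos]
        · simp only [show c - c0 - c = -c0 by ring, hc0z]
          nlinarith [mul_pos hvpos hu'pos])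
    refine ⟨-a, by linarith [ha.2], by linarith [ha.1], ?_⟩
    rw [neg_neg, show -c - -a = a - c by ring]
    exact sub_eq_zero.1 ha0
end

section
/- Let c ≥ c̃₀. If E₂ ≤ 0 satisfies −c₀ ≤ −c − E₂ < −ã₁ and v(−E₂)·u'(−c−E₂) = u(−E₂)·v'(−c−E₂) (so E₂ is the rescaled upper edge E⁰_max of the first spectral band), and E₃ ≤ 0 satisfies −a₁ < −c − E₃ ≤ −c̃₀ and v'(−E₃)·u(−c−E₃) = u'(−E₃)·v(−c−E₃) (so E₃ is the rescaled lower edge E¹_min of the second spectral band), then 0 < c̃₀ − c₀ ≤ E₃ − E₂ < a₁ − ã₁; in particular the first spectral gap is open. -/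
open Real Set

/-- The standard Airy function `Ai` expressed in the basis of the canonical
solutions `u`, `v` of the Airy equation:
`Ai(x) = u(x)/(3^(2/3)·Γ(2/3)) − v(x)/(3^(1/3)·Γ(1/3))`. -/
noncomputable def AiF (u v : ℝ → ℝ) (x : ℝ) : ℝ :=
  u x / ((3:ℝ) ^ ((2:ℝ)/3) * Real.Gamma (2/3))
    - v x / ((3:ℝ) ^ ((1:ℝ)/3) * Real.Gamma (1/3))

/-- A function with nonnegative derivative on `[-T, 0]` is bounded there by its value at `0`. -/
lemma le_apply_zero_of_deriv_nonneg {F D : ℝ → ℝ} {T : ℝ}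
    (hF : ∀ x, HasDerivAt F (D x) x) (hD : ∀ x ∈ Icc (-T) 0, 0 ≤ D x) :
    ∀ x ∈ Icc (-T) 0, F x ≤ F 0 := by
  intro x hx
  have hmono : MonotoneOn F (Icc (-T) 0) := by
    refine monotoneOn_of_deriv_nonneg (convex_Icc _ _)
      (fun y _ => (hF y).continuousAt.continuousWithinAt)
      (fun y _ => (hF y).differentiableAt.differentiableWithinAt) fun y hy => ?_
    rw [(hF y).deriv]
    exact hD y (interior_subset hy)
  exact hmono hx ⟨hx.1.trans hx.2, le_rfl⟩ hx.2

/-- A continuous function that is positive at `0` and has no zero to the right of `-T`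
is nonnegative on `[-T, 0]`, provided it vanishes at `-T`. -/
lemma nonneg_of_first_zero {f : ℝ → ℝ} (hf : Continuous f) (h0 : 0 < f 0) {T : ℝ}
    (hT : f (-T) = 0) (hne : ∀ x, -T < x → f x ≠ 0) :
    ∀ x ∈ Icc (-T) 0, 0 ≤ f x := by
  intro x hx
  by_contra! hneg
  obtain ⟨y, hy, hy0⟩ := intermediate_value_Icc hx.2 hf.continuousOn ⟨hneg.le, h0.le⟩
  rcases (hx.1.trans hy.1).eq_or_lt with h | h
  · have hxT : x = -T := le_antisymm (hy.1.trans h.ge) hx.1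
    rw [hxT, hT] at hneg
    exact lt_irrefl _ hneg
  · exact hne y h hy0

/-- Taylor lower bound for the even-type Airy solution while it stays nonnegative. -/
lemma airy_u_lower {u u' : ℝ → ℝ} (hu : ∀ x, HasDerivAt u (u' x) x)
    (huAiry : ∀ x, HasDerivAt u' (x * u x) x) (hu0 : u 0 = 1) (hu'0 : u' 0 = 0) {T : ℝ}
    (hpos : ∀ x ∈ Icc (-T) 0, 0 ≤ u x) :
    ∀ x ∈ Icc (-T) 0, 1 + x ^ 3 / 6 ≤ u x := by
  have h1 : ∀ x ∈ Icc (-T) 0, 0 ≤ u' x := fun x hx => by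
    have := le_apply_zero_of_deriv_nonneg (T := T) (fun y => (huAiry y).neg)
      (fun y hy => by nlinarith [hpos y hy, hy.2]) x hx
    simp only [Pi.neg_apply] at this
    linarith
  have h2 : ∀ x ∈ Icc (-T) 0, u x ≤ 1 := fun x hx =>
    hu0 ▸ le_apply_zero_of_deriv_nonneg hu h1 x hx
  have h3 : ∀ x ∈ Icc (-T) 0, u' x - x ^ 2 / 2 ≤ u' 0 - 0 ^ 2 / 2 :=
    le_apply_zero_of_deriv_nonneg (F := fun x => u' x - x ^ 2 / 2)
      (D := fun x => x * u x - x)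
      (fun y => ((huAiry y).sub ((hasDerivAt_pow 2 y).div_const 2)).congr_deriv
        (by push_cast; ring))
      (fun y hy => by nlinarith [h2 y hy, hy.2])
  have h4 : ∀ x ∈ Icc (-T) 0, x ^ 3 / 6 - u x ≤ 0 ^ 3 / 6 - u 0 :=
    le_apply_zero_of_deriv_nonneg (F := fun x => x ^ 3 / 6 - u x)
      (D := fun x => x ^ 2 / 2 - u' x)
      (fun y => (((hasDerivAt_pow 3 y).div_const 6).sub (hu y)).congr_deriv
        (by push_cast; ring))
      (fun y hy => by linarith [h3 y hy])
  intro x hx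
  linarith [h4 x hx]

/-- Taylor upper bound for the derivative of the odd-type Airy solution while that derivative
stays nonnegative. -/
lemma airy_v_deriv_upper {v v' : ℝ → ℝ} (hv : ∀ x, HasDerivAt v (v' x) x)
    (hvAiry : ∀ x, HasDerivAt v' (x * v x) x) (hv0 : v 0 = 0) (hv'0 : v' 0 = 1) {T : ℝ}
    (hpos : ∀ x ∈ Icc (-T) 0, 0 ≤ v' x) :
    ∀ x ∈ Icc (-T) 0, v' x ≤ 1 + x ^ 3 / 3 + x ^ 6 / 72 := by
  have h1 : ∀ x ∈ Icc (-T) 0, v x ≤ 0 := fun x hx =>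
    hv0 ▸ le_apply_zero_of_deriv_nonneg hv hpos x hx
  have h2 : ∀ x ∈ Icc (-T) 0, v' x ≤ 1 := fun x hx =>
    hv'0 ▸ le_apply_zero_of_deriv_nonneg hvAiry
      (fun y hy => mul_nonneg_of_nonpos_of_nonpos hy.2 (h1 y hy)) x hx
  have h3 : ∀ x ∈ Icc (-T) 0, x - v x ≤ 0 - v 0 :=
    le_apply_zero_of_deriv_nonneg (F := fun x => x - v x) (D := fun x => 1 - v' x)
      (fun y => (hasDerivAt_id y).sub (hv y))
      (fun y hy => by linarith [h2 y hy])
  have h4 : ∀ x ∈ Icc (-T) 0, x ^ 3 / 3 - v' x ≤ 0 ^ 3 / 3 - v' 0 :=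
    le_apply_zero_of_deriv_nonneg (F := fun x => x ^ 3 / 3 - v' x)
      (D := fun x => x ^ 2 - x * v x)
      (fun y => (((hasDerivAt_pow 3 y).div_const 3).sub (hvAiry y)).congr_deriv
        (by push_cast; ring))
      (fun y hy => by nlinarith [h3 y hy, hy.2])
  have h5 : ∀ x ∈ Icc (-T) 0, v x - x - x ^ 4 / 12 ≤ v 0 - 0 - 0 ^ 4 / 12 :=
    le_apply_zero_of_deriv_nonneg (F := fun x => v x - x - x ^ 4 / 12)
      (D := fun x => v' x - 1 - x ^ 3 / 3)
      (fun y => (((hv y).sub (hasDerivAt_id y)).sub ((hasDerivAt_pow 4 y).div_const 12)).congr_deriv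
        (by push_cast; ring))
      (fun y hy => by linarith [h4 y hy])
  have h6 : ∀ x ∈ Icc (-T) 0,
      v' x - x ^ 3 / 3 - x ^ 6 / 72 ≤ v' 0 - 0 ^ 3 / 3 - 0 ^ 6 / 72 :=
    le_apply_zero_of_deriv_nonneg (F := fun x => v' x - x ^ 3 / 3 - x ^ 6 / 72)
      (D := fun x => x * (v x - x - x ^ 4 / 12))
      (fun y => (((hvAiry y).sub ((hasDerivAt_pow 3 y).div_const 3)).sub
          ((hasDerivAt_pow 6 y).div_const 72)).congr_deriv
        (by push_cast; ring))
      (fun y hy => mul_nonneg_of_nonpos_of_nonpos hy.2 (by linarith [h5 y hy]))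
  intro x hx
  linarith [h6 x hx]

theorem stmt_11 (u v u' v' : ℝ → ℝ)
    (hu : ∀ x, HasDerivAt u (u' x) x)
    (huAiry : ∀ x, HasDerivAt u' (x * u x) x)
    (hv : ∀ x, HasDerivAt v (v' x) x)
    (hvAiry : ∀ x, HasDerivAt v' (x * v x) x)
    (hu0 : u 0 = 1) (hu'0 : u' 0 = 0) (hv0 : v 0 = 0) (hv'0 : v' 0 = 1)
    (ta1 : ℝ) (hta1pos : 0 < ta1)
    (hta1z : AiD u' v' (-ta1) = 0)
    (hta1ne : ∀ x : ℝ, -ta1 < x → AiD u' v' x ≠ 0)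
    (a1 : ℝ) (ha1pos : 0 < a1)
    (ha1z : AiF u v (-a1) = 0)
    (ha1ne : ∀ x : ℝ, -a1 < x → AiF u v x ≠ 0)
    (c0 : ℝ) (hc0pos : 0 < c0)
    (hc0z : v' (-c0) = 0)
    (hc0ne : ∀ x : ℝ, -c0 < x → v' x ≠ 0)
    (ct0 : ℝ) (hct0pos : 0 < ct0)
    (hct0z : u (-ct0) = 0)
    (hct0ne : ∀ x : ℝ, -ct0 < x → u x ≠ 0)
    (c : ℝ) (hc : ct0 ≤ c)
    (E₂ : ℝ) (hE₂le : E₂ ≤ 0)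
    (hE₂mem : -c0 ≤ -c - E₂ ∧ -c - E₂ < -ta1)
    (hE₂eq : v (-E₂) * u' (-c - E₂) = u (-E₂) * v' (-c - E₂))
    (E₃ : ℝ) (hE₃le : E₃ ≤ 0)
    (hE₃mem : -a1 < -c - E₃ ∧ -c - E₃ ≤ -ct0)
    (hE₃eq : v' (-E₃) * u (-c - E₃) = u' (-E₃) * v (-c - E₃)) :
    0 < ct0 - c0 ∧ ct0 - c0 ≤ E₃ - E₂ ∧ E₃ - E₂ < a1 - ta1 := by
  have hupos := nonneg_of_first_zero
    (continuous_iff_continuousAt.2 fun x => (hu x).continuousAt) (by simp [hu0]) hct0z hct0ne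
  have hvpos := nonneg_of_first_zero
    (continuous_iff_continuousAt.2 fun x => (hvAiry x).continuousAt) (by simp [hv'0]) hc0z hc0ne
  have hct0_gt : (17 / 10 : ℝ) < ct0 := by
    have h := airy_u_lower hu huAiry hu0 hu'0 hupos (-ct0) ⟨le_rfl, by linarith⟩
    by_contra! hle
    have hcube : ct0 ^ 3 ≤ (17 / 10) ^ 3 := by gcongr
    nlinarith
  have hc0_lt : c0 < 17 / 10 := by
    by_contra! hle
    have hmem : (-(17 / 10) : ℝ) ∈ Icc (-c0) 0 := ⟨by linarith, by norm_num⟩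
    have h := airy_v_deriv_upper hv hvAiry hv0 hv'0 hvpos _ hmem
    have hnonneg := hvpos _ hmem
    norm_num at h
    linarith
  exact ⟨by linarith, by linarith [hE₂mem.1, hE₃mem.2], by linarith [hE₂mem.2, hE₃mem.1]⟩
end
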